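/- arXiv:1809.08967 — 3 statements merged into one kernel-verified Lean document; each statement's English description precedes it below -/
import Mathlib

section
/- Error estimate for the smooth component: Suppose v=(v₁,v₂)ᵀ with v₁,v₂ ∈ C³([0,1]) solves Lv = f on (0,1) and satisfies |vᵢ''(x)| ≤ C₀ for i=1,2, |v₁⁽³⁾(x)| ≤ C₀ε₁⁻¹ and |v₂⁽³⁾(x)| ≤ C₀ε₂⁻¹ for all x ∈ [0,1]. Let V=(V₁,V₂)ᵀ be the mesh function on the Shishkin mesh satisfying (L^N V)(x_j)=f(x_j) for 1 ≤ j ≤ N−1, V(x₀)=v(0), V(x_N)=v(1). Then there is a constant C, independent of ε₁, ε₂ and N (depending on C₀, α, β and the coefficients) such that max_{0≤j≤N} max{|V₁(x_j)−v₁(x_j)|, |V₂(x_j)−v₂(x_j)|} ≤ C N⁻¹. -/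
open Set

/-- Forward difference quotient on a mesh. -/
noncomputable def Dp (x U : ℕ → ℝ) (j : ℕ) : ℝ := (U (j+1) - U j) / (x (j+1) - x j)

/-- Backward difference quotient on a mesh. -/
noncomputable def Dm (x U : ℕ → ℝ) (j : ℕ) : ℝ := (U j - U (j-1)) / (x j - x (j-1))

/-- Discrete second-order central difference on a mesh. -/
noncomputable def delta2 (x U : ℕ → ℝ) (j : ℕ) : ℝ :=
  (Dp x U j - Dm x U j) / ((x (j+1) - x (j-1)) / 2)

/-- First component of the discrete operator L^N. -/
noncomputable def LN1 (ε : ℝ) (a b₁₁ b₁₂ : ℝ → ℝ) (x Ψ₁ Ψ₂ : ℕ → ℝ) (j : ℕ) : ℝ :=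
  ε * delta2 x Ψ₁ j + a (x j) * Dp x Ψ₁ j - b₁₁ (x j) * Ψ₁ j + b₁₂ (x j) * Ψ₂ j

/-- Second component of the discrete operator L^N. -/
noncomputable def LN2 (ε : ℝ) (a b₂₂ b₂₁ : ℝ → ℝ) (x Ψ₁ Ψ₂ : ℕ → ℝ) (j : ℕ) : ℝ :=
  ε * delta2 x Ψ₂ j + a (x j) * Dp x Ψ₂ j - b₂₂ (x j) * Ψ₂ j + b₂₁ (x j) * Ψ₁ j

/-- The piecewise-uniform Shishkin mesh on [0,1] with transition parameters
τ₂ = min{1/2, (2ε₂/α) ln N} and τ₁ = min{τ₂/2, (2ε₁/α) ln N}. -/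
noncomputable def shMesh (N : ℕ) (α ε₁ ε₂ : ℝ) (j : ℕ) : ℝ :=
  let τ₂ : ℝ := min (1/2) ((2 * ε₂ / α) * Real.log (N : ℝ))
  let τ₁ : ℝ := min (τ₂ / 2) ((2 * ε₁ / α) * Real.log (N : ℝ))
  if j ≤ N / 4 then (j : ℝ) * (4 * τ₁ / N)
  else if j ≤ N / 2 then τ₁ + ((j : ℝ) - (N : ℝ) / 4) * (4 * (τ₂ - τ₁) / N)
  else τ₂ + ((j : ℝ) - (N : ℝ) / 2) * (2 * (1 - τ₂) / N)

section ShishkinMesh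

lemma shMesh_zero (N : ℕ) (α ε₁ ε₂ : ℝ) : shMesh N α ε₁ ε₂ 0 = 0 := by
  simp [shMesh]

lemma shMesh_last {N : ℕ} (hN : 4 ≤ N) (α ε₁ ε₂ : ℝ) : shMesh N α ε₁ ε₂ N = 1 := by
  have h1 : ¬ N ≤ N / 4 := by omega
  have h2 : ¬ N ≤ N / 2 := by omega
  have hN' : (N : ℝ) ≠ 0 := by positivity
  simp only [shMesh, h1, h2, if_false]
  field_simp
  ring

/-- Consecutive points of the Shishkin mesh are distinct and at most `2 / N` apart. -/
lemma shMesh_step {N : ℕ} (hN : 4 ≤ N) (h4 : 4 ∣ N) {α ε₁ ε₂ : ℝ} (hα : 0 < α)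
    (hε₁ : 0 < ε₁) (hε : ε₁ < ε₂) (j : ℕ) :
    0 < shMesh N α ε₁ ε₂ (j + 1) - shMesh N α ε₁ ε₂ j ∧
      shMesh N α ε₁ ε₂ (j + 1) - shMesh N α ε₁ ε₂ j ≤ 2 / N := by
  obtain ⟨m, rfl⟩ := h4
  have hm : (0 : ℝ) < m := by exact_mod_cast (show 0 < m by omega)
  have hlog : 0 < Real.log ((4 * m : ℕ) : ℝ) :=
    Real.log_pos (by exact_mod_cast (show 1 < 4 * m by omega))
  have hε₂ : 0 < ε₂ := hε₁.trans hε
  have hq : 4 * m / 4 = m := by omega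
  have hh : 4 * m / 2 = 2 * m := by omega
  have e1 : 0 < 2 * ε₁ / α * Real.log ((4 * m : ℕ) : ℝ) := by positivity
  have e2 : 0 < 2 * ε₂ / α * Real.log ((4 * m : ℕ) : ℝ) := by positivity
  simp only [shMesh, hq, hh]
  generalize 2 * ε₁ / α * Real.log ((4 * m : ℕ) : ℝ) = s₁ at *
  generalize 2 * ε₂ / α * Real.log ((4 * m : ℕ) : ℝ) = s₂ at *
  have t2 : 0 < min (1 / 2) s₂ := lt_min (by norm_num) e2
  have t2' : min (1 / 2) s₂ ≤ 1 / 2 := min_le_left _ _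
  generalize min (1 / 2) s₂ = τ₂ at *
  have t1 : 0 < min (τ₂ / 2) s₁ := lt_min (by linarith) e1
  have t1' : min (τ₂ / 2) s₁ ≤ τ₂ / 2 := min_le_left _ _
  generalize min (τ₂ / 2) s₁ = τ₁ at *
  have key : ∀ d k : ℝ, 0 < k → k ≤ 2 → d * (4 * m) = k →
      0 < d ∧ d ≤ 2 / ((4 * m : ℕ) : ℝ) := by
    intro d k hk hk2 hd
    have hd' : d = k / (4 * m) := by field_simp; linarith
    push_cast
    rw [hd']
    exact ⟨by positivity, by gcongr⟩
  rcases lt_trichotomy j m with h | rfl | h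
  · rw [if_pos (show j + 1 ≤ m by omega), if_pos (show j ≤ m by omega)]
    refine key _ (4 * τ₁) (by linarith) (by linarith) ?_
    push_cast; field_simp; ring
  · rw [if_neg (show ¬ j + 1 ≤ j by omega), if_pos (show j + 1 ≤ 2 * j by omega), if_pos le_rfl]
    refine key _ (4 * (τ₂ - τ₁)) (by linarith) (by linarith) ?_
    push_cast; field_simp; ring
  rw [if_neg (show ¬ j + 1 ≤ m by omega), if_neg (show ¬ j ≤ m by omega)]
  rcases lt_trichotomy j (2 * m) with h' | rfl | h'
  · rw [if_pos (show j + 1 ≤ 2 * m by omega), if_pos (show j ≤ 2 * m by omega)]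
    refine key _ (4 * (τ₂ - τ₁)) (by linarith) (by linarith) ?_
    push_cast; field_simp; ring
  · rw [if_neg (show ¬ 2 * m + 1 ≤ 2 * m by omega), if_pos le_rfl]
    refine key _ (2 * (1 - τ₂)) (by linarith) (by linarith) ?_
    push_cast; field_simp; ring
  · rw [if_neg (show ¬ j + 1 ≤ 2 * m by omega), if_neg (show ¬ j ≤ 2 * m by omega)]
    refine key _ (2 * (1 - τ₂)) (by linarith) (by linarith) ?_
    push_cast; field_simp; ring

end ShishkinMesh

section Taylor

lemma abs_sub_le_of_abs_deriv_le {g : ℝ → ℝ} (hg : Differentiable ℝ g) {c t K : ℝ}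
    (hK : ∀ s ∈ uIcc c t, |deriv g s| ≤ K) : |g t - g c| ≤ K * |t - c| :=
  (convex_uIcc c t).norm_image_sub_le_of_norm_deriv_le (fun s _ => hg s) hK
    left_mem_uIcc right_mem_uIcc

lemma abs_sub_le_of_mem_uIcc {c t s : ℝ} (hs : s ∈ uIcc c t) : |s - c| ≤ |t - c| := by
  simpa using abs_sub_left_of_mem_uIcc hs

/-- First-order Taylor estimate (with a non-optimal constant). -/
lemma abs_taylor_one_le {g : ℝ → ℝ} (hg : Differentiable ℝ g) (hg' : Differentiable ℝ (deriv g))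
    {c t K : ℝ} (hK : ∀ s ∈ uIcc c t, |deriv (deriv g) s| ≤ K) :
    |g t - g c - deriv g c * (t - c)| ≤ K * |t - c| ^ 2 := by
  have hK0 : 0 ≤ K := (abs_nonneg _).trans (hK c left_mem_uIcc)
  have hd : ∀ s, HasDerivAt (fun s => g s - deriv g c * (s - c)) (deriv g s - deriv g c) s := by
    intro s
    refine ((hg s).hasDerivAt.sub
      (((hasDerivAt_id s).sub_const c).const_mul (deriv g c))).congr_deriv ?_
    simp
  have h := abs_sub_le_of_abs_deriv_le (c := c) (t := t) (K := K * |t - c|)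
    (fun s => (hd s).differentiableAt) (fun s hs => by
      rw [(hd s).deriv]
      refine (abs_sub_le_of_abs_deriv_le hg' fun r hr => hK r ?_).trans ?_
      · exact uIcc_subset_uIcc_left hs hr
      · exact mul_le_mul_of_nonneg_left (abs_sub_le_of_mem_uIcc hs) hK0)
  calc _ = |g t - deriv g c * (t - c) - (g c - deriv g c * (c - c))| := by ring_nf
    _ ≤ _ := h
    _ = _ := by ring

/-- Second-order Taylor estimate (with a non-optimal constant). -/
lemma abs_taylor_two_le {g : ℝ → ℝ} (hg : Differentiable ℝ g) (hg' : Differentiable ℝ (deriv g))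
    (hg'' : Differentiable ℝ (deriv (deriv g)))
    {c t K : ℝ} (hK : ∀ s ∈ uIcc c t, |deriv (deriv (deriv g)) s| ≤ K) :
    |g t - g c - deriv g c * (t - c) - deriv (deriv g) c * (t - c) ^ 2 / 2| ≤ K * |t - c| ^ 3 := by
  have hK0 : 0 ≤ K := (abs_nonneg _).trans (hK c left_mem_uIcc)
  have hd : ∀ s, HasDerivAt
      (fun s => g s - deriv g c * (s - c) - deriv (deriv g) c * (s - c) ^ 2 / 2)
      (deriv g s - deriv g c - deriv (deriv g) c * (s - c)) s := by
    intro s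
    have h1 := (hasDerivAt_id s).sub_const c
    refine (((hg s).hasDerivAt.sub (h1.const_mul (deriv g c))).sub
      (((h1.pow 2).const_mul (deriv (deriv g) c)).div_const 2)).congr_deriv ?_
    simp
    ring
  have h := abs_sub_le_of_abs_deriv_le (c := c) (t := t) (K := K * |t - c| ^ 2)
    (fun s => (hd s).differentiableAt) (fun s hs => by
      rw [(hd s).deriv]
      refine (abs_taylor_one_le hg' hg'' fun r hr => hK r ?_).trans ?_
      · exact uIcc_subset_uIcc_left hs hr
      · exact mul_le_mul_of_nonneg_left
          (pow_le_pow_left₀ (abs_nonneg _) (abs_sub_le_of_mem_uIcc hs) 2) hK0)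
  calc _ = |g t - deriv g c * (t - c) - deriv (deriv g) c * (t - c) ^ 2 / 2
        - (g c - deriv g c * (c - c) - deriv (deriv g) c * (c - c) ^ 2 / 2)| := by ring_nf
    _ ≤ _ := h
    _ = _ := by ring

end Taylor

section Truncation

variable {x : ℕ → ℝ} {j : ℕ} {g : ℝ → ℝ} {h K : ℝ}

lemma abs_Dp_sub_deriv_le (hg : Differentiable ℝ g) (hg' : Differentiable ℝ (deriv g))
    (hx : x j < x (j + 1)) (hh : x (j + 1) - x j ≤ h)
    (hK : ∀ s ∈ Icc (x j) (x (j + 1)), |deriv (deriv g) s| ≤ K) :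
    |Dp x (fun i => g (x i)) j - deriv g (x j)| ≤ K * h := by
  have hd : 0 < x (j + 1) - x j := sub_pos.2 hx
  have hK0 : 0 ≤ K := (abs_nonneg _).trans (hK _ (left_mem_Icc.2 hx.le))
  have ht := abs_taylor_one_le hg hg' (c := x j) (t := x (j + 1)) (K := K)
    (by rwa [uIcc_of_le hx.le])
  rw [abs_of_pos hd] at ht
  have e : Dp x (fun i => g (x i)) j - deriv g (x j)
      = (g (x (j + 1)) - g (x j) - deriv g (x j) * (x (j + 1) - x j)) / (x (j + 1) - x j) := by
    rw [Dp]; field_simp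
  rw [e, abs_div, abs_of_pos hd, div_le_iff₀ hd]
  nlinarith [mul_le_mul_of_nonneg_left hh (mul_nonneg hK0 hd.le)]

lemma abs_delta2_sub_deriv_le (hg : Differentiable ℝ g) (hg' : Differentiable ℝ (deriv g))
    (hg'' : Differentiable ℝ (deriv (deriv g)))
    (hx : x j < x (j + 1)) (hh : x (j + 1) - x j ≤ h)
    (hx' : x (j - 1) < x j) (hh' : x j - x (j - 1) ≤ h)
    (hK : ∀ s ∈ Icc (x (j - 1)) (x (j + 1)), |deriv (deriv (deriv g)) s| ≤ K) :
    |delta2 x (fun i => g (x i)) j - deriv (deriv g) (x j)| ≤ 2 * K * h := by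
  have hd : 0 < x (j + 1) - x j := sub_pos.2 hx
  have hd' : 0 < x j - x (j - 1) := sub_pos.2 hx'
  have hK0 : 0 ≤ K := (abs_nonneg _).trans (hK _ ⟨hx'.le, hx.le⟩)
  have ht := abs_taylor_two_le hg hg' hg'' (c := x j) (t := x (j + 1)) (K := K)
    (by rw [uIcc_of_le hx.le]; exact fun s hs => hK s ⟨hx'.le.trans hs.1, hs.2⟩)
  have ht' := abs_taylor_two_le hg hg' hg'' (c := x j) (t := x (j - 1)) (K := K)
    (by rw [uIcc_of_ge hx'.le]; exact fun s hs => hK s ⟨hs.1, hs.2.trans hx.le⟩)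
  rw [abs_of_pos hd] at ht
  rw [abs_sub_comm (x (j - 1)), abs_of_pos hd'] at ht'
  have e : delta2 x (fun i => g (x i)) j - deriv (deriv g) (x j)
      = ((g (x (j + 1)) - g (x j) - deriv g (x j) * (x (j + 1) - x j)
            - deriv (deriv g) (x j) * (x (j + 1) - x j) ^ 2 / 2) / (x (j + 1) - x j)
          + (g (x (j - 1)) - g (x j) - deriv g (x j) * (x (j - 1) - x j)
            - deriv (deriv g) (x j) * (x (j - 1) - x j) ^ 2 / 2) / (x j - x (j - 1)))
          / ((x (j + 1) - x (j - 1)) / 2) := by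
    have hs : x (j + 1) - x (j - 1) ≠ 0 := by linarith
    rw [delta2, Dp, Dm]
    field_simp
    ring
  rw [e, abs_div, abs_of_pos (by linarith : 0 < (x (j + 1) - x (j - 1)) / 2),
    div_le_iff₀ (by linarith)]
  refine (abs_add_le _ _).trans ?_
  rw [abs_div, abs_div, abs_of_pos hd, abs_of_pos hd']
  have b1 := (div_le_iff₀ hd).2 (ht.trans_eq (show K * (x (j + 1) - x j) ^ 3
    = K * (x (j + 1) - x j) ^ 2 * (x (j + 1) - x j) by ring))
  have b2 := (div_le_iff₀ hd').2 (ht'.trans_eq (show K * (x j - x (j - 1)) ^ 3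
    = K * (x j - x (j - 1)) ^ 2 * (x j - x (j - 1)) by ring))
  nlinarith [mul_le_mul_of_nonneg_left hh (mul_nonneg hK0 hd.le),
    mul_le_mul_of_nonneg_left hh' (mul_nonneg hK0 hd'.le)]

/-- Truncation error of the first component of the discrete operator. -/
lemma abs_LN1_sub_le {ε A C₀ : ℝ} {a b c g₂ : ℝ → ℝ} (hg : ContDiff ℝ 3 g)
    (hε : 0 < ε) (hA : |a (x j)| ≤ A)
    (hx : x j < x (j + 1)) (hh : x (j + 1) - x j ≤ h)
    (hx' : x (j - 1) < x j) (hh' : x j - x (j - 1) ≤ h)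
    (h2 : ∀ s ∈ Icc (x (j - 1)) (x (j + 1)), |iteratedDeriv 2 g s| ≤ C₀)
    (h3 : ∀ s ∈ Icc (x (j - 1)) (x (j + 1)), |iteratedDeriv 3 g s| ≤ C₀ / ε) :
    |LN1 ε a b c x (fun i => g (x i)) (fun i => g₂ (x i)) j
      - (ε * deriv (deriv g) (x j) + a (x j) * deriv g (x j) - b (x j) * g (x j)
        + c (x j) * g₂ (x j))| ≤ (2 + A) * C₀ * h := by
  have i2 : iteratedDeriv 2 g = deriv (deriv g) := by
    rw [iteratedDeriv_succ, iteratedDeriv_one]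
  have i3 : iteratedDeriv 3 g = deriv (deriv (deriv g)) := by
    rw [iteratedDeriv_succ, i2]
  rw [i2] at h2
  rw [i3] at h3
  have d0 : Differentiable ℝ g := hg.differentiable (by norm_num)
  have d1 : Differentiable ℝ (deriv g) := by
    simpa using hg.differentiable_iteratedDeriv 1 (by norm_num)
  have d2 : Differentiable ℝ (deriv (deriv g)) := by
    simpa [i2] using hg.differentiable_iteratedDeriv 2 (by norm_num)
  have k1 := abs_Dp_sub_deriv_le d0 d1 hx hh fun s hs => h2 s ⟨hx'.le.trans hs.1, hs.2⟩
  have k2 := abs_delta2_sub_deriv_le d0 d1 d2 hx hh hx' hh' h3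
  have e : LN1 ε a b c x (fun i => g (x i)) (fun i => g₂ (x i)) j
      - (ε * deriv (deriv g) (x j) + a (x j) * deriv g (x j) - b (x j) * g (x j)
        + c (x j) * g₂ (x j))
      = ε * (delta2 x (fun i => g (x i)) j - deriv (deriv g) (x j))
        + a (x j) * (Dp x (fun i => g (x i)) j - deriv g (x j)) := by
    rw [LN1]; ring
  rw [e]
  refine (abs_add_le _ _).trans ?_
  rw [abs_mul, abs_mul, abs_of_pos hε]
  have m1 := mul_le_mul_of_nonneg_left k2 hε.le
  have m2 := mul_le_mul hA k1 (abs_nonneg _) ((abs_nonneg _).trans hA)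
  have e1 : ε * (2 * (C₀ / ε) * h) = 2 * C₀ * h := by field_simp
  linarith

end Truncation

section Stability

lemma LN1_sub (ε : ℝ) (a b c : ℝ → ℝ) (x U₁ U₂ W₁ W₂ : ℕ → ℝ) (j : ℕ) :
    LN1 ε a b c x (fun i => U₁ i - W₁ i) (fun i => U₂ i - W₂ i) j
      = LN1 ε a b c x U₁ U₂ j - LN1 ε a b c x W₁ W₂ j := by
  simp only [LN1, delta2, Dp, Dm]
  ring

/-- At an interior node where the first component attains the nonnegative maximum `M` of both
components, the discrete operator is at most `-β * M`. -/
lemma mul_le_neg_LN1_of_isMax {ε β M : ℝ} {a b c : ℝ → ℝ} {x U₁ U₂ : ℕ → ℝ} {j : ℕ}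
    (hε : 0 < ε) (ha : 0 ≤ a (x j)) (hc : 0 ≤ c (x j)) (hb : β ≤ b (x j) - c (x j))
    (hx : x j < x (j + 1)) (hx' : x (j - 1) < x j) (hM : 0 ≤ M) (hj : U₁ j = M)
    (hr : U₁ (j + 1) ≤ M) (hl : U₁ (j - 1) ≤ M) (h₂ : U₂ j ≤ M) :
    β * M ≤ -LN1 ε a b c x U₁ U₂ j := by
  have hp : Dp x U₁ j ≤ 0 := div_nonpos_of_nonpos_of_nonneg (by linarith) (by linarith)
  have hm : 0 ≤ Dm x U₁ j := div_nonneg (by linarith) (by linarith)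
  have hd : delta2 x U₁ j ≤ 0 := div_nonpos_of_nonpos_of_nonneg (by linarith) (by linarith)
  have m1 := mul_nonpos_of_nonneg_of_nonpos hε.le hd
  have m2 := mul_nonpos_of_nonneg_of_nonpos ha hp
  have m3 := mul_le_mul_of_nonneg_left h₂ hc
  have m4 := mul_le_mul_of_nonneg_right hb hM
  rw [LN1, hj]
  linarith

/-- Discrete maximum principle for the coupled upwind system. -/
lemma le_div_of_neg_LN1_le {N : ℕ} {ε₁ ε₂ β T : ℝ} {a₁ a₂ b₁ b₂ c₁ c₂ : ℝ → ℝ}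
    {x U₁ U₂ : ℕ → ℝ} (hε₁ : 0 < ε₁) (hε₂ : 0 < ε₂) (hβ : 0 < β) (hT : 0 ≤ T)
    (hx : ∀ j < N, x j < x (j + 1))
    (ha₁ : ∀ j ≤ N, 0 ≤ a₁ (x j)) (ha₂ : ∀ j ≤ N, 0 ≤ a₂ (x j))
    (hc₁ : ∀ j ≤ N, 0 ≤ c₁ (x j)) (hc₂ : ∀ j ≤ N, 0 ≤ c₂ (x j))
    (hb₁ : ∀ j ≤ N, β ≤ b₁ (x j) - c₁ (x j)) (hb₂ : ∀ j ≤ N, β ≤ b₂ (x j) - c₂ (x j))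
    (h₁ : ∀ j, 1 ≤ j → j < N → -LN1 ε₁ a₁ b₁ c₁ x U₁ U₂ j ≤ T)
    (h₂ : ∀ j, 1 ≤ j → j < N → -LN1 ε₂ a₂ b₂ c₂ x U₂ U₁ j ≤ T)
    (hl₁ : U₁ 0 ≤ 0) (hl₂ : U₂ 0 ≤ 0) (hr₁ : U₁ N ≤ 0) (hr₂ : U₂ N ≤ 0) :
    ∀ j ≤ N, U₁ j ≤ T / β ∧ U₂ j ≤ T / β := by
  obtain ⟨k, hk, hmax⟩ := Finset.exists_max_image (Finset.range (N + 1))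
    (fun j => max (U₁ j) (U₂ j)) ⟨0, by simp⟩
  have hkN : k ≤ N := Nat.lt_succ_iff.1 (Finset.mem_range.1 hk)
  set M := max (U₁ k) (U₂ k) with hMdef
  have hmax' : ∀ j ≤ N, U₁ j ≤ M ∧ U₂ j ≤ M := fun j hj =>
    max_le_iff.1 (hmax j (Finset.mem_range.2 (Nat.lt_succ_of_le hj)))
  suffices hM : M ≤ T / β from fun j hj => ⟨(hmax' j hj).1.trans hM, (hmax' j hj).2.trans hM⟩
  rcases le_or_gt M 0 with hM0 | hM0
  · exact hM0.trans (by positivity)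
  have hk0 : k ≠ 0 := by
    rintro rfl
    exact absurd (max_le hl₁ hl₂) (not_le.2 hM0)
  have hkN' : k ≠ N := by
    rintro rfl
    exact absurd (max_le hr₁ hr₂) (not_le.2 hM0)
  have hlt : k < N := lt_of_le_of_ne hkN hkN'
  have hx' : x (k - 1) < x k := by
    have := hx (k - 1) (by omega)
    rwa [Nat.sub_add_cancel (by omega)] at this
  have hn := hmax' (k + 1) hlt
  have hp := hmax' (k - 1) (by omega)
  have hs := hmax' k hkN
  rw [le_div_iff₀' hβ]
  rcases max_choice (U₁ k) (U₂ k) with h | h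
  · exact (mul_le_neg_LN1_of_isMax hε₁ (ha₁ k hkN) (hc₁ k hkN) (hb₁ k hkN) (hx k hlt) hx' hM0.le
      h.symm hn.1 hp.1 hs.2).trans (h₁ k (by omega) hlt)
  · exact (mul_le_neg_LN1_of_isMax hε₂ (ha₂ k hkN) (hc₂ k hkN) (hb₂ k hkN) (hx k hlt) hx' hM0.le
      h.symm hn.2 hp.2 hs.1).trans (h₂ k (by omega) hlt)

/-- Stability of the coupled upwind system: the difference of two mesh functions with the same
boundary values is controlled by the difference of their images. -/
lemma abs_sub_le_of_abs_LN1_sub_le {N : ℕ} {ε₁ ε₂ β T : ℝ} {a₁ a₂ b₁ b₂ c₁ c₂ : ℝ → ℝ}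
    {x U₁ U₂ W₁ W₂ : ℕ → ℝ} (hε₁ : 0 < ε₁) (hε₂ : 0 < ε₂) (hβ : 0 < β) (hT : 0 ≤ T)
    (hx : ∀ j < N, x j < x (j + 1))
    (ha₁ : ∀ j ≤ N, 0 ≤ a₁ (x j)) (ha₂ : ∀ j ≤ N, 0 ≤ a₂ (x j))
    (hc₁ : ∀ j ≤ N, 0 ≤ c₁ (x j)) (hc₂ : ∀ j ≤ N, 0 ≤ c₂ (x j))
    (hb₁ : ∀ j ≤ N, β ≤ b₁ (x j) - c₁ (x j)) (hb₂ : ∀ j ≤ N, β ≤ b₂ (x j) - c₂ (x j))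
    (h₁ : ∀ j, 1 ≤ j → j < N →
      |LN1 ε₁ a₁ b₁ c₁ x W₁ W₂ j - LN1 ε₁ a₁ b₁ c₁ x U₁ U₂ j| ≤ T)
    (h₂ : ∀ j, 1 ≤ j → j < N →
      |LN1 ε₂ a₂ b₂ c₂ x W₂ W₁ j - LN1 ε₂ a₂ b₂ c₂ x U₂ U₁ j| ≤ T)
    (hl₁ : U₁ 0 = W₁ 0) (hl₂ : U₂ 0 = W₂ 0) (hr₁ : U₁ N = W₁ N) (hr₂ : U₂ N = W₂ N) :
    ∀ j ≤ N, |U₁ j - W₁ j| ≤ T / β ∧ |U₂ j - W₂ j| ≤ T / β := by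
  intro j hj
  have hup := le_div_of_neg_LN1_le (U₁ := fun i => U₁ i - W₁ i) (U₂ := fun i => U₂ i - W₂ i)
    hε₁ hε₂ hβ hT hx ha₁ ha₂ hc₁ hc₂ hb₁ hb₂
    (fun i hi hiN => by rw [LN1_sub]; linarith [(abs_le.1 (h₁ i hi hiN)).2])
    (fun i hi hiN => by rw [LN1_sub]; linarith [(abs_le.1 (h₂ i hi hiN)).2])
    (by linarith) (by linarith) (by linarith) (by linarith) j hj
  have hlo := le_div_of_neg_LN1_le (U₁ := fun i => W₁ i - U₁ i) (U₂ := fun i => W₂ i - U₂ i)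
    hε₁ hε₂ hβ hT hx ha₁ ha₂ hc₁ hc₂ hb₁ hb₂
    (fun i hi hiN => by rw [LN1_sub]; linarith [(abs_le.1 (h₁ i hi hiN)).1])
    (fun i hi hiN => by rw [LN1_sub]; linarith [(abs_le.1 (h₂ i hi hiN)).1])
    (by linarith) (by linarith) (by linarith) (by linarith) j hj
  exact ⟨abs_le.2 ⟨by linarith [hlo.1], hup.1⟩, abs_le.2 ⟨by linarith [hlo.2], hup.2⟩⟩

end Stability

/-- First-order parameter-uniform error estimate for the smooth component on the
Shishkin mesh. -/
theorem smooth_component_error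
    (α β C₀ : ℝ) (a₁ a₂ b₁₁ b₁₂ b₂₁ b₂₂ f₁ f₂ : ℝ → ℝ)
    (hα : 0 < α) (hβ : 0 < β) (hC₀ : 0 ≤ C₀)
    (ha₁s : ContDiff ℝ 1 a₁) (ha₂s : ContDiff ℝ 1 a₂)
    (hb₁₁s : ContDiff ℝ 1 b₁₁) (hb₁₂s : ContDiff ℝ 1 b₁₂)
    (hb₂₁s : ContDiff ℝ 1 b₂₁) (hb₂₂s : ContDiff ℝ 1 b₂₂)
    (hf₁ : Continuous f₁) (hf₂ : Continuous f₂)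
    (ha₁ : ∀ x ∈ Icc (0:ℝ) 1, α ≤ a₁ x) (ha₂ : ∀ x ∈ Icc (0:ℝ) 1, α ≤ a₂ x)
    (hb₁ : ∀ x ∈ Icc (0:ℝ) 1, β ≤ b₁₁ x - b₁₂ x)
    (hb₂ : ∀ x ∈ Icc (0:ℝ) 1, β ≤ b₂₂ x - b₂₁ x)
    (hb₁₂ : ∀ x ∈ Icc (0:ℝ) 1, 0 < b₁₂ x) (hb₂₁ : ∀ x ∈ Icc (0:ℝ) 1, 0 < b₂₁ x) :
    ∃ C : ℝ, 0 < C ∧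
      ∀ ε₁ ε₂ : ℝ, 0 < ε₁ → ε₁ < ε₂ → ε₂ ≤ 1 →
      ∀ N : ℕ, 4 ≤ N → 4 ∣ N →
      ∀ v₁ v₂ : ℝ → ℝ, ContDiff ℝ 3 v₁ → ContDiff ℝ 3 v₂ →
        (∀ x ∈ Ioo (0:ℝ) 1,
          ε₁ * deriv (deriv v₁) x + a₁ x * deriv v₁ x - b₁₁ x * v₁ x + b₁₂ x * v₂ x
            = f₁ x ∧
          ε₂ * deriv (deriv v₂) x + a₂ x * deriv v₂ x - b₂₂ x * v₂ x + b₂₁ x * v₁ x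
            = f₂ x) →
        (∀ x ∈ Icc (0:ℝ) 1,
          |iteratedDeriv 2 v₁ x| ≤ C₀ ∧ |iteratedDeriv 2 v₂ x| ≤ C₀ ∧
          |iteratedDeriv 3 v₁ x| ≤ C₀ / ε₁ ∧ |iteratedDeriv 3 v₂ x| ≤ C₀ / ε₂) →
        ∀ V₁ V₂ : ℕ → ℝ,
          (∀ j, 1 ≤ j → j < N →
            LN1 ε₁ a₁ b₁₁ b₁₂ (shMesh N α ε₁ ε₂) V₁ V₂ j = f₁ (shMesh N α ε₁ ε₂ j) ∧
            LN2 ε₂ a₂ b₂₂ b₂₁ (shMesh N α ε₁ ε₂) V₁ V₂ j = f₂ (shMesh N α ε₁ ε₂ j)) →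
          V₁ 0 = v₁ 0 → V₂ 0 = v₂ 0 → V₁ N = v₁ 1 → V₂ N = v₂ 1 →
          ∀ j ≤ N,
            |V₁ j - v₁ (shMesh N α ε₁ ε₂ j)| ≤ C / N ∧
            |V₂ j - v₂ (shMesh N α ε₁ ε₂ j)| ≤ C / N := by
  obtain ⟨A₁, hA₁⟩ := isCompact_Icc.exists_bound_of_continuousOn
    (ha₁s.continuous.continuousOn (s := Icc (0 : ℝ) 1))
  obtain ⟨A₂, hA₂⟩ := isCompact_Icc.exists_bound_of_continuousOn
    (ha₂s.continuous.continuousOn (s := Icc (0 : ℝ) 1))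
  set A := max A₁ A₂ with hA
  have hA0 : 0 ≤ A :=
    ((norm_nonneg _).trans (hA₁ 0 (by simp))).trans (le_max_left _ _)
  refine ⟨2 * (2 + A) * C₀ / β + 1, by positivity, ?_⟩
  intro ε₁ ε₂ hε₁ hε _ N hN h4 v₁ v₂ hv₁ hv₂ hode hbd V₁ V₂ hV hl₁ hl₂ hr₁ hr₂
  have hstep := shMesh_step hN h4 hα hε₁ hε
  have hx0 := shMesh_zero N α ε₁ ε₂
  have hxN := shMesh_last hN α ε₁ ε₂
  generalize shMesh N α ε₁ ε₂ = x at *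
  have hε₂ : 0 < ε₂ := hε₁.trans hε
  have hNpos : (0 : ℝ) < N := by positivity
  have hmono : StrictMono x := strictMono_nat_of_lt_succ fun j => sub_pos.1 (hstep j).1
  have hmem : ∀ j ≤ N, x j ∈ Icc (0 : ℝ) 1 := fun j hj =>
    ⟨hx0 ▸ hmono.monotone (Nat.zero_le j), hxN ▸ hmono.monotone hj⟩
  have hsub : ∀ j, j < N → ∀ s ∈ Icc (x (j - 1)) (x (j + 1)), s ∈ Icc (0 : ℝ) 1 :=
    fun j hj s hs => ⟨(hmem (j - 1) (by omega)).1.trans hs.1, hs.2.trans (hmem (j + 1) hj).2⟩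
  have hIoo : ∀ j, 1 ≤ j → j < N → x j ∈ Ioo (0 : ℝ) 1 := fun j hj hjN =>
    ⟨hx0 ▸ hmono (by omega : 0 < j), hxN ▸ hmono hjN⟩
  have hprev : ∀ j, 1 ≤ j → x (j - 1) < x j ∧ x j - x (j - 1) ≤ 2 / N := fun j hj => by
    have := hstep (j - 1)
    rw [Nat.sub_add_cancel hj] at this
    exact ⟨sub_pos.1 this.1, this.2⟩
  have hmain := abs_sub_le_of_abs_LN1_sub_le (N := N) (β := β) (T := (2 + A) * C₀ * (2 / N))
    (x := x) (U₁ := V₁) (U₂ := V₂) (W₁ := fun i => v₁ (x i)) (W₂ := fun i => v₂ (x i))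
    (a₁ := a₁) (a₂ := a₂) (b₁ := b₁₁) (b₂ := b₂₂) (c₁ := b₁₂) (c₂ := b₂₁)
    hε₁ hε₂ hβ (by positivity) (fun j _ => hmono (Nat.lt_succ_self j))
    (fun j hj => hα.le.trans (ha₁ _ (hmem j hj))) (fun j hj => hα.le.trans (ha₂ _ (hmem j hj)))
    (fun j hj => (hb₁₂ _ (hmem j hj)).le) (fun j hj => (hb₂₁ _ (hmem j hj)).le)
    (fun j hj => hb₁ _ (hmem j hj)) (fun j hj => hb₂ _ (hmem j hj))
    (fun j hj hjN => by
      rw [(hV j hj hjN).1, ← (hode _ (hIoo j hj hjN)).1]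
      exact abs_LN1_sub_le hv₁ hε₁ ((hA₁ _ (hmem j hjN.le)).trans (le_max_left _ _))
        (hmono (Nat.lt_succ_self j)) (hstep j).2 (hprev j hj).1 (hprev j hj).2
        (fun s hs => (hbd s (hsub j hjN s hs)).1) fun s hs => (hbd s (hsub j hjN s hs)).2.2.1)
    (fun j hj hjN => by
      rw [show LN1 ε₂ a₂ b₂₂ b₂₁ x V₂ V₁ j = f₂ (x j) from (hV j hj hjN).2,
        ← (hode _ (hIoo j hj hjN)).2]
      exact abs_LN1_sub_le hv₂ hε₂ ((hA₂ _ (hmem j hjN.le)).trans (le_max_right _ _))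
        (hmono (Nat.lt_succ_self j)) (hstep j).2 (hprev j hj).1 (hprev j hj).2
        (fun s hs => (hbd s (hsub j hjN s hs)).2.1) fun s hs => (hbd s (hsub j hjN s hs)).2.2.2)
    (by simpa [hx0] using hl₁) (by simpa [hx0] using hl₂)
    (by simpa [hxN] using hr₁) (by simpa [hxN] using hr₂)
  have hC : (2 + A) * C₀ * (2 / N) / β ≤ (2 * (2 + A) * C₀ / β + 1) / N := by
    have e : (2 + A) * C₀ * (2 / N) / β = (2 * (2 + A) * C₀ / β) / N := by field_simp
    rw [e]
    gcongr
    linarith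
  exact fun j hj => ⟨(hmain j hj).1.trans hC, (hmain j hj).2.trans hC⟩
end

section
/- Discrete barrier identities on a uniform mesh: Let N ∈ ℕ, h=1/N, x_j=jh, and for ε>0 and γ>0 set λ=1+γh/ε and Y_j=(λ^{N−j}−1)/(λ^{N}−1) for 0 ≤ j ≤ N. Then: (i) 0 ≤ Y_j ≤ 1 for all j; (ii) ε δ²Y_j + γ D⁺Y_j = 0 for 1 ≤ j ≤ N−1, where D⁺Y_j=(Y_{j+1}−Y_j)/h, D⁻Y_j=(Y_j−Y_{j−1})/h, δ²Y_j=(D⁺Y_j−D⁻Y_j)/h; and (iii) D⁺Y_j ≤ −(γ/ε)·exp(−γx_{j+1}/ε) for 0 ≤ j ≤ N−1. -/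
open Set

/-- The forward difference quotient of `(lam ^ k - 1) / D`, for decreasing exponents. -/
lemma barrier_forward_difference {h lam ε γ : ℝ} (hh : h ≠ 0) (hlam : lam = 1 + γ * h / ε)
    (D : ℝ) (k : ℕ) :
    ((lam ^ k - 1) / D - (lam ^ (k + 1) - 1) / D) / h = -(γ / ε) * (lam ^ k / D) := by
  have hr : (1 - lam) / h = -(γ / ε) := by
    rw [hlam]
    field_simp
    ring
  rw [← hr]
  ring

lemma exp_neg_mul_pow_one_add_le_one {a : ℝ} (ha : 0 ≤ a) (k : ℕ) :
    Real.exp (-(k * a)) * (1 + a) ^ k ≤ 1 := by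
  have hpow : (1 + a) ^ k ≤ Real.exp (k * a) := by
    rw [Real.exp_nat_mul]
    exact pow_le_pow_left₀ (by positivity) (by linarith [Real.add_one_le_exp a]) k
  calc Real.exp (-(k * a)) * (1 + a) ^ k
      ≤ Real.exp (-(k * a)) * Real.exp (k * a) := by gcongr
    _ = 1 := by rw [← Real.exp_add, neg_add_cancel, Real.exp_zero]

/-- Discrete barrier identities for Y_j = (λ^{N-j} - 1)/(λ^N - 1) with
λ = 1 + γh/ε on the uniform mesh x_j = jh, h = 1/N. -/
theorem discrete_barrier_identities
    (N : ℕ) (hN : 1 ≤ N) (ε γ : ℝ) (hε : 0 < ε) (hγ : 0 < γ) :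
    ∀ h lam : ℝ, h = 1 / (N : ℝ) → lam = 1 + γ * h / ε →
    ∀ Y : ℕ → ℝ, (∀ j, Y j = (lam ^ (N - j) - 1) / (lam ^ N - 1)) →
      (∀ j ≤ N, 0 ≤ Y j ∧ Y j ≤ 1) ∧
      (∀ j, 1 ≤ j → j < N →
        ε * (((Y (j+1) - Y j) / h - (Y j - Y (j-1)) / h) / h)
          + γ * ((Y (j+1) - Y j) / h) = 0) ∧
      (∀ j < N,
        (Y (j+1) - Y j) / h ≤ -(γ / ε) * Real.exp (-γ * ((j + 1 : ℕ) : ℝ) * h / ε)) := by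
  intro h lam hh hlam Y hY
  have hNpos : (0 : ℝ) < N := by exact_mod_cast hN
  have hpos : 0 < h := by rw [hh]; positivity
  have ha : 0 < γ * h / ε := by positivity
  have hone : 1 < lam := by linarith
  have hD : 0 < lam ^ N - 1 := sub_pos.2 (one_lt_pow₀ hone (by lia))
  have hdiff : ∀ j < N, (Y (j + 1) - Y j) / h =
      -(γ / ε) * (lam ^ (N - (j + 1)) / (lam ^ N - 1)) := by
    intro j hj
    rw [hY, hY, ← barrier_forward_difference hpos.ne' hlam,
      show N - (j + 1) + 1 = N - j by lia]
  refine ⟨fun j _ => ?_, fun j hj hjN => ?_, fun j hj => ?_⟩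
  · rw [hY]
    refine ⟨div_nonneg (sub_nonneg.2 (one_le_pow₀ hone.le)) hD.le, (div_le_one hD).2 ?_⟩
    gcongr
    · exact hone.le
    · exact Nat.sub_le N j
  · obtain ⟨i, rfl⟩ := Nat.exists_eq_add_of_le' hj
    rw [Nat.add_sub_cancel, hdiff _ hjN, hdiff i (by lia),
      show N - (i + 1) = N - (i + 1 + 1) + 1 by lia, pow_succ]
    generalize lam ^ (N - (i + 1 + 1)) = p
    generalize lam ^ N - 1 = D at hD
    rw [hlam]
    field_simp
    ring
  · rw [hdiff j hj]
    refine mul_le_mul_of_nonpos_left ?_ (neg_nonpos.2 (by positivity))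
    rw [show -γ * ((j + 1 : ℕ) : ℝ) * h / ε = -((j + 1 : ℕ) * (γ * h / ε)) by ring,
      le_div_iff₀ hD]
    have hexp := exp_neg_mul_pow_one_add_le_one ha.le (j + 1)
    rw [← hlam] at hexp
    calc _ ≤ Real.exp (-((j + 1 : ℕ) * (γ * h / ε))) * lam ^ N := by
          gcongr
          linarith
      _ = Real.exp (-((j + 1 : ℕ) * (γ * h / ε))) * lam ^ (j + 1) * lam ^ (N - (j + 1)) := by
          rw [mul_assoc, ← pow_add, Nat.add_sub_cancel' hj]
      _ ≤ lam ^ (N - (j + 1)) := mul_le_of_le_one_left (by positivity) hexp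
end

section
/- Error estimate for the singular component: Suppose w=(w₁,w₂)ᵀ with w₁,w₂ ∈ C³([0,1]) solves Lw = 0 on (0,1) with w(1)=0 and max{|w₁(0)|,|w₂(0)|} ≤ C₀. Let W=(W₁,W₂)ᵀ be the mesh function on the Shishkin mesh satisfying (L^N W)(x_j)=0 for 1 ≤ j ≤ N−1, W(x₀)=w(0), W(x_N)=w(1). Then there is a constant C, independent of ε₁, ε₂ and N (depending on C₀, α, β and the coefficients) such that max_{0≤j≤N} max{|W₁(x_j)−w₁(x_j)|, |W₂(x_j)−w₂(x_j)|} ≤ C N⁻¹ ln N. -/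
open Set

/-! ### Mean value estimates and a one-dimensional comparison principle -/

/-- A function whose derivative is dominated by that of `M` has increments dominated by those
of `M`. -/
lemma abs_sub_le_sub_of_abs_deriv_le {f f' M M' : ℝ → ℝ} {u v : ℝ} (huv : u ≤ v)
    (hf : ∀ t ∈ Icc u v, HasDerivAt f (f' t) t) (hM : ∀ t ∈ Icc u v, HasDerivAt M (M' t) t)
    (h : ∀ t ∈ Icc u v, |f' t| ≤ M' t) : |f v - f u| ≤ M v - M u := by
  have hmono : ∀ s : ℝ, |s| ≤ 1 → s * (f v - f u) ≤ M v - M u := by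
    intro s hs
    have hd : ∀ t ∈ Icc u v, HasDerivAt (fun t => M t - s * f t) (M' t - s * f' t) t :=
      fun t ht => (hM t ht).sub ((hf t ht).const_mul s)
    have hm : MonotoneOn (fun t => M t - s * f t) (Icc u v) := by
      refine monotoneOn_of_deriv_nonneg (convex_Icc u v)
        (fun t ht => (hd t ht).continuousAt.continuousWithinAt)
        (fun t ht => (hd t (interior_subset ht)).differentiableAt.differentiableWithinAt) ?_
      intro t ht
      have ht' := interior_subset ht
      rw [(hd t ht').deriv]
      have h1 : s * f' t ≤ |f' t| := by
        calc s * f' t ≤ |s * f' t| := le_abs_self _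
          _ = |s| * |f' t| := abs_mul _ _
          _ ≤ 1 * |f' t| := by gcongr
          _ = |f' t| := one_mul _
      linarith [h t ht']
    have := hm (left_mem_Icc.2 huv) (right_mem_Icc.2 huv) huv
    simp only at this
    linarith
  refine abs_le.2 ⟨?_, ?_⟩
  · linarith [hmono (-1) (by norm_num)]
  · linarith [hmono 1 (by norm_num)]

/-- The second derivative is nonpositive at a local maximum. -/
lemma IsLocalMax.secondDeriv_nonpos {f : ℝ → ℝ} {x : ℝ} (h : IsLocalMax f x)
    (hf : ContinuousAt f x) : deriv (deriv f) x ≤ 0 := by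
  by_contra! hpos
  have hmin := isLocalMin_of_deriv_deriv_pos hpos h.deriv_eq_zero hf
  have hconst : f =ᶠ[nhds x] fun _ => f x := by
    filter_upwards [h, hmin] with y h1 h2 using le_antisymm h1 h2
  have h2 : deriv f =ᶠ[nhds x] deriv (fun _ => f x) := hconst.deriv
  have h3 := h2.deriv_eq
  simp at h3
  linarith

/-- Exponential decay for `ε v' + a v = g` with `a ≥ α > 0` and bounded `g`. -/
lemma le_exp_decay_of_linear_ode {ε α G : ℝ} (hε : 0 < ε) (hα : 0 < α) (hG : 0 ≤ G)
    {a g v v' : ℝ → ℝ}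
    (hv : ∀ t ∈ Icc (0 : ℝ) 1, HasDerivAt v (v' t) t)
    (ha : ∀ t ∈ Icc (0 : ℝ) 1, α ≤ a t) (hg : ∀ t ∈ Icc (0 : ℝ) 1, g t ≤ G)
    (hode : ∀ t ∈ Icc (0 : ℝ) 1, ε * v' t + a t * v t = g t) :
    ∀ t ∈ Icc (0 : ℝ) 1, v t ≤ |v 0| * Real.exp (-(α / ε) * t) + (G + 1) / α := by
  have hB : ∀ t, HasDerivAt (fun t => |v 0| * Real.exp (-(α / ε) * t) + (G + 1) / α)
      (|v 0| * (Real.exp (-(α / ε) * t) * (-(α / ε)))) t := by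
    intro t
    have := (((hasDerivAt_id t).const_mul (-(α / ε))).exp.const_mul |v 0|).add_const ((G + 1) / α)
    simpa using this
  intro t ht
  refine image_le_of_deriv_right_lt_deriv_boundary (f := v) (f' := v')
    (fun s hs => (hv s hs).continuousAt.continuousWithinAt)
    (fun s hs => (hv s (Ico_subset_Icc_self hs)).hasDerivWithinAt) ?_ hB ?_ ht
  · simp only [mul_zero, Real.exp_zero, mul_one]
    have : 0 < (G + 1) / α := by positivity
    linarith [le_abs_self (v 0)]
  · intro s hs heq
    have hs' := Ico_subset_Icc_self hs
    have h1 := hode s hs'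
    have hpos : 0 ≤ v s := by rw [heq]; positivity
    have h2 : α * v s ≤ a s * v s := mul_le_mul_of_nonneg_right (ha s hs') hpos
    have h3 := hg s hs'
    have h4 : α * v s = α * (|v 0| * Real.exp (-(α / ε) * s)) + (G + 1) := by
      rw [heq]; field_simp
    have h5 : ε * (|v 0| * (Real.exp (-(α / ε) * s) * (-(α / ε))))
        = -(α * (|v 0| * Real.exp (-(α / ε) * s))) := by field_simp
    have : ε * v' s < ε * (|v 0| * (Real.exp (-(α / ε) * s) * (-(α / ε)))) := by
      rw [h5]; linarith
    exact lt_of_mul_lt_mul_left this hε.le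

/-! ### Meshes and stability of the discrete convection-diffusion recurrence -/

/-- A mesh on `[0,1]` with steps at most `2 / N` whose step sizes have bounded relative
variation. -/
structure IsStepMesh (N : ℕ) (x : ℕ → ℝ) : Prop where
  pos : 0 < N
  zero : x 0 = 0
  last : x N = 1
  lt : ∀ j < N, x j < x (j + 1)
  step_le : ∀ j < N, x (j + 1) - x j ≤ 2 / N
  variation : ∑ j ∈ Finset.range (N - 1),
    |(x (j + 2) - x (j + 1)) - (x (j + 1) - x j)| / (x (j + 2) - x (j + 1)) ≤ 2

namespace IsStepMesh

variable {N : ℕ} {x : ℕ → ℝ}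

lemma le_of_le (hx : IsStepMesh N x) {i j : ℕ} (hij : i ≤ j) (hj : j ≤ N) : x i ≤ x j := by
  induction j, hij using Nat.le_induction with
  | base => exact le_rfl
  | succ k _ ih => exact (ih (by omega)).trans (hx.lt k (by omega)).le

lemma mem_Icc (hx : IsStepMesh N x) {j : ℕ} (hj : j ≤ N) : x j ∈ Icc (0 : ℝ) 1 :=
  ⟨hx.zero ▸ hx.le_of_le (Nat.zero_le j) hj, hx.last ▸ hx.le_of_le hj le_rfl⟩

lemma cell_subset (hx : IsStepMesh N x) {j : ℕ} (hj : j < N) :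
    Icc (x j) (x (j + 1)) ⊆ Icc (0 : ℝ) 1 :=
  Icc_subset_Icc (hx.mem_Icc hj.le).1 (hx.mem_Icc (Nat.succ_le_of_lt hj)).2

end IsStepMesh

/-- Solutions of the discrete first-order recurrence with summable data have summable mesh
primitive. -/
lemma exists_recurrence_of_summable_data {N : ℕ} {H a r : ℕ → ℝ} {ε α S : ℝ} (hε : 0 < ε)
    (hα : 0 < α) (hH : ∀ j < N, 0 < H j) (ha : ∀ j ≤ N, α ≤ a j)
    (hS : ∑ j ∈ Finset.range (N - 1), |r j| ≤ S) :
    ∃ p : ℕ → ℝ,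
      (∀ j, j + 1 < N →
        ε * (p (j + 1) - p j) + a (j + 1) * ((H j + H (j + 1)) / 2) * p (j + 1) = r j) ∧
      ∀ n ≤ N, |∑ j ∈ Finset.range n, H j * p j| ≤ 2 / α * S := by
  let p : ℕ → ℝ := fun n => Nat.rec 0
    (fun j y => (ε * y + r j) / (ε + a (j + 1) * ((H j + H (j + 1)) / 2))) n
  have hp : ∀ j, p (j + 1) = (ε * p j + r j) / (ε + a (j + 1) * ((H j + H (j + 1)) / 2)) :=
    fun j => rfl
  have hS0 : 0 ≤ S := (Finset.sum_nonneg fun _ _ => abs_nonneg _).trans hS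
  have heq : ∀ j, j + 1 < N →
      ε * (p (j + 1) - p j) + a (j + 1) * ((H j + H (j + 1)) / 2) * p (j + 1) = r j := by
    intro j hj
    have h1 := hH j (by omega)
    have h2 := hH (j + 1) hj
    have h3 := ha (j + 1) hj.le
    have h4 : 0 < a (j + 1) := hα.trans_le h3
    have hne : ε + a (j + 1) * ((H j + H (j + 1)) / 2) ≠ 0 := by positivity
    have := hp j
    rw [eq_div_iff hne] at this
    linarith
  refine ⟨p, heq, ?_⟩
  have key : ∀ n, n + 1 ≤ N →
      ε * |p n| + α / 2 * |∑ j ∈ Finset.range (n + 1), H j * p j|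
        ≤ ∑ j ∈ Finset.range n, |r j| := by
    intro n
    induction n with
    | zero => intro _; simp [p]
    | succ n ih =>
      intro hn
      have h0 := ih (by omega)
      have h1 := hH n (by omega)
      have h2 := hH (n + 1) (by omega)
      have h3 := ha (n + 1) (by omega)
      rw [Finset.sum_range_succ _ (n + 1), Finset.sum_range_succ (fun j => |r j|) n]
      set s := ∑ j ∈ Finset.range (n + 1), H j * p j
      have e := heq n (by omega)
      have h4 : (ε + a (n + 1) * ((H n + H (n + 1)) / 2)) * |p (n + 1)| ≤ ε * |p n| + |r n| := by
        have hpos : 0 ≤ ε + a (n + 1) * ((H n + H (n + 1)) / 2) := by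
          have : 0 < a (n + 1) := hα.trans_le h3
          positivity
        calc _ = |(ε + a (n + 1) * ((H n + H (n + 1)) / 2)) * p (n + 1)| := by
              rw [abs_mul, abs_of_nonneg hpos]
          _ = |ε * p n + r n| := by congr 1; linarith
          _ ≤ |ε * p n| + |r n| := abs_add_le _ _
          _ = _ := by rw [abs_mul, abs_of_pos hε]
      have h5 : |s + H (n + 1) * p (n + 1)| ≤ |s| + H (n + 1) * |p (n + 1)| := by
        refine (abs_add_le _ _).trans ?_
        rw [abs_mul, abs_of_pos h2]
      have h6 : α / 2 * (H (n + 1) * |p (n + 1)|)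
          ≤ a (n + 1) * ((H n + H (n + 1)) / 2) * |p (n + 1)| := by
        rw [← mul_assoc]
        refine mul_le_mul_of_nonneg_right ?_ (abs_nonneg _)
        nlinarith
      have h7 := mul_le_mul_of_nonneg_left h5 (by positivity : 0 ≤ α / 2)
      linarith
  intro n hn
  rcases n with _ | n
  · simp; positivity
  · have h1 := key n hn
    have h2 : ∑ j ∈ Finset.range n, |r j| ≤ ∑ j ∈ Finset.range (N - 1), |r j| :=
      Finset.sum_le_sum_of_subset_of_nonneg (Finset.range_mono (by omega))
        fun _ _ _ => abs_nonneg _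
    have h3 : 0 ≤ ε * |p n| := by positivity
    rw [div_mul_eq_mul_div, le_div_iff₀ hα]
    linarith

/-- Solutions of the discrete first-order recurrence with data in divergence form are controlled
by the maximum norm of the flux. -/
lemma exists_recurrence_of_flux_data {N : ℕ} {H a q : ℕ → ℝ} {ε α A Z V : ℝ} (hε : 0 < ε)
    (hα : 0 < α) (hA : 0 ≤ A) (hH : ∀ j < N, 0 < H j) (ha : ∀ j ≤ N, α ≤ a j)
    (haH : ∀ j < N, |a (j + 1) - a j| ≤ A * H j) (hHsum : ∀ n ≤ N, ∑ j ∈ Finset.range n, H j ≤ 1)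
    (hV : ∑ j ∈ Finset.range (N - 1), |H (j + 1) - H j| / H (j + 1) ≤ V)
    (hN : 0 < N) (hq : ∀ j < N, ε * |q j| ≤ Z) :
    ∃ p : ℕ → ℝ,
      (∀ j, j + 1 < N →
        ε * (p (j + 1) - p j) + a (j + 1) * ((H j + H (j + 1)) / 2) * p (j + 1)
          = -(ε * (q (j + 1) - q j))) ∧
      ∀ n ≤ N, |∑ j ∈ Finset.range n, H j * p j| ≤ (2 / α + A / α ^ 2 + 2 / α * V) * Z := by
  let z : ℕ → ℝ := fun n => Nat.rec (q 0)
    (fun j y => (ε * y + a (j + 1) * ((H j + H (j + 1)) / 2) * q (j + 1))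
      / (ε + a (j + 1) * ((H j + H (j + 1)) / 2))) n
  have hz : ∀ j, z (j + 1) = (ε * z j + a (j + 1) * ((H j + H (j + 1)) / 2) * q (j + 1))
      / (ε + a (j + 1) * ((H j + H (j + 1)) / 2)) := fun j => rfl
  have hz0 : z 0 = q 0 := rfl
  have hZ : 0 ≤ Z := le_trans (by positivity) (hq 0 hN)
  have hc : ∀ j, j + 1 < N → 0 < a (j + 1) * ((H j + H (j + 1)) / 2) := by
    intro j hj
    have h1 := hH j (by omega)
    have h2 := hH (j + 1) hj
    have h4 : 0 < a (j + 1) := hα.trans_le (ha (j + 1) hj.le)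
    positivity
  have heq : ∀ j, j + 1 < N → a (j + 1) * ((H j + H (j + 1)) / 2) * (z (j + 1) - q (j + 1))
      = -(ε * (z (j + 1) - z j)) := by
    intro j hj
    have h1 := hc j hj
    have hne : ε + a (j + 1) * ((H j + H (j + 1)) / 2) ≠ 0 := by positivity
    have := hz j
    rw [eq_div_iff hne] at this
    linarith
  have hzZ : ∀ j, j < N → ε * |z j| ≤ Z := by
    intro j
    induction j with
    | zero => intro h; exact hz0 ▸ hq 0 h
    | succ j ih =>
      intro hj
      have h1 := hc j hj
      have h2 := ih (by omega)
      have h3 := hq (j + 1) hj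
      have h4 := hz j
      generalize a (j + 1) * ((H j + H (j + 1)) / 2) = c at *
      have hpos : 0 < ε + c := by positivity
      rw [h4, abs_div, abs_of_pos hpos, mul_div_assoc', div_le_iff₀ hpos]
      have h5 : |ε * z j + c * q (j + 1)| ≤ ε * |z j| + c * |q (j + 1)| := by
        refine (abs_add_le _ _).trans ?_
        rw [abs_mul, abs_mul, abs_of_pos hε, abs_of_pos h1]
      nlinarith [mul_le_mul_of_nonneg_left h5 hε.le, mul_le_mul_of_nonneg_left h2 hε.le,
        mul_le_mul_of_nonneg_left h3 h1.le]
  refine ⟨fun j => z j - q j, fun j hj => by have := heq j hj; linarith, ?_⟩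
  have key : ∀ n, n + 1 ≤ N →
      |(∑ j ∈ Finset.range (n + 1), H j * (z j - q j)) + ε * z n / a n|
        ≤ (1 / α + A / α ^ 2 * (∑ j ∈ Finset.range n, H j)
            + 2 / α * ∑ j ∈ Finset.range n, |H (j + 1) - H j| / H (j + 1)) * Z := by
    intro n
    induction n with
    | zero =>
      intro h
      have h1 := hzZ 0 h
      have h2 := ha 0 (Nat.zero_le N)
      simp only [zero_add, Finset.range_one, Finset.sum_singleton, Finset.range_zero,
        Finset.sum_empty, mul_zero, add_zero]
      rw [hz0, sub_self, mul_zero, zero_add, ← hz0, abs_div, abs_mul, abs_of_pos hε,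
        abs_of_pos (hα.trans_le h2), one_div_mul_eq_div]
      gcongr
    | succ n ih =>
      intro hn
      have h0 := ih (by omega)
      have h1 := hH n (by omega)
      have h2 := hH (n + 1) (by omega)
      have ha1 := ha (n + 1) (by omega)
      have ha0 := ha n (by omega)
      have hz1 := hzZ (n + 1) (by omega)
      have hz0 := hzZ n (by omega)
      have hap1 := hα.trans_le ha1
      have hap0 := hα.trans_le ha0
      have e := heq n (by omega)
      rw [Finset.sum_range_succ _ (n + 1), Finset.sum_range_succ (fun j => H j) n,
        Finset.sum_range_succ (fun j => |H (j + 1) - H j| / H (j + 1)) n]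
      set s := ∑ j ∈ Finset.range (n + 1), H j * (z j - q j)
      have hstep : H (n + 1) * (z (n + 1) - q (n + 1))
          = -(H (n + 1) / (a (n + 1) * ((H n + H (n + 1)) / 2)) * (ε * (z (n + 1) - z n))) := by
        rw [← mul_neg, ← e]
        field_simp
      have hdec : s + H (n + 1) * (z (n + 1) - q (n + 1)) + ε * z (n + 1) / a (n + 1)
          = (s + ε * z n / a n) + (ε * z n) * ((a n - a (n + 1)) / (a n * a (n + 1)))
            + (H n - H (n + 1)) / (H n + H (n + 1)) / a (n + 1) * (ε * z (n + 1) - ε * z n) := by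
        rw [hstep]
        field_simp
        ring
      have hz0' : |ε * z n| ≤ Z := by rwa [abs_mul, abs_of_pos hε]
      have hz1' : |ε * z (n + 1)| ≤ Z := by rwa [abs_mul, abs_of_pos hε]
      have hb1 : |(ε * z n) * ((a n - a (n + 1)) / (a n * a (n + 1)))|
          ≤ Z * (A * H n / α ^ 2) := by
        rw [abs_mul, abs_div, abs_of_pos (mul_pos hap0 hap1), abs_sub_comm, sq]
        gcongr
        exact haH n (by omega)
      have hb2 : |(H n - H (n + 1)) / (H n + H (n + 1)) / a (n + 1) * (ε * z (n + 1) - ε * z n)|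
          ≤ |H (n + 1) - H n| / H (n + 1) / α * (Z + Z) := by
        rw [abs_mul, abs_div, abs_div, abs_of_pos hap1, abs_sub_comm (H n),
          abs_of_pos (by positivity : 0 < H n + H (n + 1))]
        gcongr
        · linarith
        · exact (abs_sub _ _).trans (add_le_add hz1' hz0')
      rw [hdec]
      refine (abs_add_three _ _ _).trans ((add_le_add (add_le_add h0 hb1) hb2).trans_eq ?_)
      field_simp
      ring
  intro n hn
  rcases n with _ | n
  · have hV0 : 0 ≤ V := le_trans (Finset.sum_nonneg fun j hj => by
      have := hH (j + 1) (by have := Finset.mem_range.1 hj; omega)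
      positivity) hV
    simp; positivity
  · have h1 := key n hn
    have h2 : ∑ j ∈ Finset.range n, |H (j + 1) - H j| / H (j + 1) ≤ V := by
      refine le_trans (Finset.sum_le_sum_of_subset_of_nonneg (Finset.range_mono (by omega))
        fun j hj _ => ?_) hV
      have := hH (j + 1) (by have := Finset.mem_range.1 hj; omega)
      positivity
    have h3 := hHsum n (by omega)
    have h4 : |ε * z n / a n| ≤ 1 / α * Z := by
      rw [abs_div, abs_mul, abs_of_pos hε, abs_of_pos (hα.trans_le (ha n (by omega))),
        one_div_mul_eq_div]
      gcongr
      · exact hzZ n (by omega)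
      · exact ha n (by omega)
    have h5 : (1 / α + A / α ^ 2 * (∑ j ∈ Finset.range n, H j)
        + 2 / α * ∑ j ∈ Finset.range n, |H (j + 1) - H j| / H (j + 1)) * Z
        ≤ (1 / α + A / α ^ 2 * 1 + 2 / α * V) * Z := by gcongr
    set s := ∑ j ∈ Finset.range (n + 1), H j * (z j - q j)
    have h6 : |s| ≤ |s + ε * z n / a n| + |ε * z n / a n| := by
      calc |s| = |(s + ε * z n / a n) - ε * z n / a n| := by ring_nf
        _ ≤ _ := abs_sub _ _
    refine (h6.trans (add_le_add (h1.trans h5) h4)).trans_eq ?_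
    ring

/-! ### Consistency of the upwind scheme in a negative norm -/

lemma delta2_succ (x U : ℕ → ℝ) (j : ℕ) :
    delta2 x U (j + 1) = (Dp x U (j + 1) - Dp x U j) / ((x (j + 2) - x j) / 2) := rfl

/-- On a step mesh, the upwind truncation error for `ε w'' + a w' = g` is the image under the
discrete convection-diffusion operator of a mesh function that is small wherever the increments of
`w` over the mesh cells are small. The increments are measured through functions `M` and `Mg` whose
derivatives dominate those of `w` and `g`. -/
lemma exists_upwind_corrector {N : ℕ} {x : ℕ → ℝ} (hx : IsStepMesh N x)
    {ε α A G D δ : ℝ} (hε : 0 < ε) (hα : 0 < α) (hA : 0 ≤ A) (hG : 0 ≤ G)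
    {a a' w w' w'' g g' M M' Mg Mg' : ℝ → ℝ}
    (ha : ∀ t ∈ Icc (0 : ℝ) 1, HasDerivAt a (a' t) t)
    (haα : ∀ t ∈ Icc (0 : ℝ) 1, α ≤ a t) (haA : ∀ t ∈ Icc (0 : ℝ) 1, a t ≤ A)
    (haA' : ∀ t ∈ Icc (0 : ℝ) 1, |a' t| ≤ A)
    (hw : ∀ t ∈ Icc (0 : ℝ) 1, HasDerivAt w (w' t) t)
    (hw' : ∀ t ∈ Icc (0 : ℝ) 1, HasDerivAt w' (w'' t) t)
    (hode : ∀ t ∈ Icc (0 : ℝ) 1, ε * w'' t + a t * w' t = g t)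
    (hg : ∀ t ∈ Icc (0 : ℝ) 1, HasDerivAt g (g' t) t) (hgG : ∀ t ∈ Icc (0 : ℝ) 1, |g t| ≤ G)
    (hM : ∀ t ∈ Icc (0 : ℝ) 1, HasDerivAt M (M' t) t)
    (hMg : ∀ t ∈ Icc (0 : ℝ) 1, HasDerivAt Mg (Mg' t) t)
    (hwM : ∀ t ∈ Icc (0 : ℝ) 1, |w' t| ≤ M' t) (hgM : ∀ t ∈ Icc (0 : ℝ) 1, |g' t| ≤ Mg' t)
    (hMD : M 1 - M 0 ≤ D) (hMgD : Mg 1 - Mg 0 ≤ D)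
    (hMδ : ∀ j < N, M (x (j + 1)) - M (x j) ≤ δ) (hNδ : 2 / (N : ℝ) ≤ δ) :
    ∃ η : ℕ → ℝ, η 0 = 0 ∧
      (∀ j, j + 1 < N →
        ε * delta2 x η (j + 1) + a (x (j + 1)) * Dp x η (j + 1) = g (x (j + 1)) -
          (ε * delta2 x (fun i => w (x i)) (j + 1)
            + a (x (j + 1)) * Dp x (fun i => w (x i)) (j + 1))) ∧
      ∀ j ≤ N, |η j| ≤ (2 / α * ((1 + A) * D + (G + A))
        + (2 / α + A / α ^ 2 + 2 / α * 2) * (G + A)) * δ := by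
  have hsub : ∀ {j}, j < N → ∀ {t}, t ∈ Icc (x j) (x (j + 1)) → t ∈ Icc (0 : ℝ) 1 :=
    fun hj _ ht => hx.cell_subset hj ht
  have hlt := hx.lt
  let H : ℕ → ℝ := fun j => x (j + 1) - x j
  have hHdef : ∀ j, H j = x (j + 1) - x j := fun j => rfl
  have hH : ∀ j < N, 0 < H j := fun j hj => sub_pos.2 (hx.lt j hj)
  have hHδ : ∀ j < N, H j ≤ δ := fun j hj => (hx.step_le j hj).trans hNδ
  have hHsum : ∀ n, ∑ j ∈ Finset.range n, H j = x n := by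
    intro n
    rw [Finset.sum_range_sub, hx.zero, sub_zero]
  have hδ : 0 ≤ δ := le_trans (by positivity) hNδ
  -- increments over a cell
  have hwc : ∀ j < N, |w (x (j + 1)) - w (x j)| ≤ M (x (j + 1)) - M (x j) := fun j hj =>
    abs_sub_le_sub_of_abs_deriv_le (hlt j hj).le (fun t ht => hw t (hsub hj ht))
      (fun t ht => hM t (hsub hj ht)) (fun t ht => hwM t (hsub hj ht))
  have hM0 : ∀ j < N, 0 ≤ M (x (j + 1)) - M (x j) := fun j hj => (abs_nonneg _).trans (hwc j hj)
  have hgc : ∀ j < N, ∀ t ∈ Icc (x j) (x (j + 1)),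
      |g t - g (x j)| ≤ Mg (x (j + 1)) - Mg (x j) := by
    intro j hj t ht
    have h1 := abs_sub_le_sub_of_abs_deriv_le ht.1
      (fun s hs => hg s (hsub hj ⟨hs.1, hs.2.trans ht.2⟩))
      (fun s hs => hMg s (hsub hj ⟨hs.1, hs.2.trans ht.2⟩))
      (fun s hs => hgM s (hsub hj ⟨hs.1, hs.2.trans ht.2⟩))
    have h2 := abs_sub_le_sub_of_abs_deriv_le ht.2
      (fun s hs => hg s (hsub hj ⟨ht.1.trans hs.1, hs.2⟩))
      (fun s hs => hMg s (hsub hj ⟨ht.1.trans hs.1, hs.2⟩))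
      (fun s hs => hgM s (hsub hj ⟨ht.1.trans hs.1, hs.2⟩))
    linarith [abs_nonneg (g (x (j + 1)) - g t)]
  have hMg0 : ∀ j < N, 0 ≤ Mg (x (j + 1)) - Mg (x j) := fun j hj =>
    (abs_nonneg _).trans (hgc j hj _ (left_mem_Icc.2 (hlt j hj).le))
  have hac : ∀ j < N, ∀ t ∈ Icc (x j) (x (j + 1)), |a t - a (x j)| ≤ A * H j := by
    intro j hj t ht
    have h1 := abs_sub_le_sub_of_abs_deriv_le (M := fun s => A * s) (M' := fun _ => A) ht.1
      (fun s hs => ha s (hsub hj ⟨hs.1, hs.2.trans ht.2⟩))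
      (fun s _ => by simpa using (hasDerivAt_id s).const_mul A)
      (fun s hs => haA' s (hsub hj ⟨hs.1, hs.2.trans ht.2⟩))
    have h2 : A * t ≤ A * x (j + 1) := mul_le_mul_of_nonneg_left ht.2 hA
    simp only [hHdef, mul_sub]
    linarith
  -- the flux error
  let q : ℕ → ℝ := fun j => (w (x (j + 1)) - w (x j)) / H j - w' (x (j + 1))
  have hq : ∀ j < N, ε * |q j| ≤ (G + A) * δ := by
    intro j hj
    obtain ⟨c, hc, hcw⟩ := exists_hasDerivAt_eq_slope w w' (hlt j hj)
      (fun t ht => (hw t (hsub hj ht)).continuousAt.continuousWithinAt)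
      (fun t ht => hw t (hsub hj (Ioo_subset_Icc_self ht)))
    have hc' := Ioo_subset_Icc_self hc
    have h1 := abs_sub_le_sub_of_abs_deriv_le (f := fun t => ε * w' t) (f' := fun t => ε * w'' t)
      (M := fun t => G * t + A * M t) (M' := fun t => G * 1 + A * M' t) hc'.2
      (fun t ht => (hw' t (hsub hj ⟨hc'.1.trans ht.1, ht.2⟩)).const_mul ε)
      (fun t ht => ((hasDerivAt_id t).const_mul G).add
        ((hM t (hsub hj ⟨hc'.1.trans ht.1, ht.2⟩)).const_mul A)) ?_
    · have h2 := abs_sub_le_sub_of_abs_deriv_le hc'.1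
        (fun s hs => hw s (hsub hj ⟨hs.1, hs.2.trans hc'.2⟩))
        (fun s hs => hM s (hsub hj ⟨hs.1, hs.2.trans hc'.2⟩))
        (fun s hs => hwM s (hsub hj ⟨hs.1, hs.2.trans hc'.2⟩))
      have h3 : M (x j) ≤ M c := by linarith [abs_nonneg (w c - w (x j))]
      have h4 : q j = -(w' (x (j + 1)) - w' c) := by
        simp only [q, hHdef, ← hcw]; ring
      have h7 : ε * |q j| = |ε * w' (x (j + 1)) - ε * w' c| := by
        rw [h4, abs_neg, ← mul_sub, abs_mul, abs_of_pos hε]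
      rw [h7]
      refine h1.trans ?_
      have h5 : G * (x (j + 1) - c) ≤ G * δ :=
        mul_le_mul_of_nonneg_left (by linarith [hHδ j hj, hc'.1, hHdef j]) hG
      have h6 : A * (M (x (j + 1)) - M c) ≤ A * δ :=
        mul_le_mul_of_nonneg_left (by linarith [hMδ j hj]) hA
      linarith
    · intro t ht
      have ht' := hsub hj ⟨hc'.1.trans ht.1, ht.2⟩
      have e : ε * w'' t = g t - a t * w' t := by linarith [hode t ht']
      rw [e]
      refine (abs_sub _ _).trans ?_
      rw [abs_mul, abs_of_nonneg (hα.le.trans (haα t ht')), mul_one]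
      exact add_le_add (hgG t ht')
        (mul_le_mul (haA t ht') (hwM t ht') (abs_nonneg _) hA)
  -- the remainder
  let σ : ℕ → ℝ := fun j => |H (j + 1) - H j| / H (j + 1)
  have hσ : ∑ j ∈ Finset.range (N - 1), σ j ≤ 2 := hx.variation
  let r : ℕ → ℝ := fun j =>
    (H j + H (j + 1)) / 2 * (g (x (j + 1))
      - a (x (j + 1)) * ((w (x (j + 2)) - w (x (j + 1))) / H (j + 1)))
      - ε * (w' (x (j + 2)) - w' (x (j + 1)))
  have hr : ∀ j, j + 1 < N → |r j| ≤
      δ * ((Mg (x (j + 2)) - Mg (x (j + 1))) + A * (M (x (j + 2)) - M (x (j + 1))))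
        + σ j / 2 * ((G + A) * δ) := by
    intro j hj
    have hHj := hH (j + 1) hj
    have hxj := hx.mem_Icc hj.le
    have hdec : r j = (H (j + 1) * g (x (j + 1)) - a (x (j + 1)) * (w (x (j + 2)) - w (x (j + 1)))
          - ε * (w' (x (j + 2)) - w' (x (j + 1))))
        + (H j - H (j + 1)) / H (j + 1) / 2 * (H (j + 1) * g (x (j + 1))
          - a (x (j + 1)) * (w (x (j + 2)) - w (x (j + 1)))) := by
      simp only [r]
      field_simp
      ring
    have h1 : |H (j + 1) * g (x (j + 1)) - a (x (j + 1)) * (w (x (j + 2)) - w (x (j + 1)))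
          - ε * (w' (x (j + 2)) - w' (x (j + 1)))| ≤
        H (j + 1) * ((Mg (x (j + 2)) - Mg (x (j + 1))) + A * (M (x (j + 2)) - M (x (j + 1)))) := by
      have h := abs_sub_le_sub_of_abs_deriv_le
        (f := fun t => t * g (x (j + 1)) - a (x (j + 1)) * w t - ε * w' t)
        (f' := fun t => 1 * g (x (j + 1)) - a (x (j + 1)) * w' t - ε * w'' t)
        (M := fun t => (Mg (x (j + 2)) - Mg (x (j + 1))) * t + A * H (j + 1) * M t)
        (M' := fun t => (Mg (x (j + 2)) - Mg (x (j + 1))) * 1 + A * H (j + 1) * M' t)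
        (hlt (j + 1) hj).le
        (fun t ht => (((hasDerivAt_id t).mul_const _).sub ((hw t (hsub hj ht)).const_mul _)).sub
          ((hw' t (hsub hj ht)).const_mul ε))
        (fun t ht => ((hasDerivAt_id t).const_mul _).add ((hM t (hsub hj ht)).const_mul _)) ?_
      · rw [hHdef] at h ⊢
        refine (le_of_eq ?_).trans (h.trans (le_of_eq ?_))
        · congr 1; ring
        · ring
      · intro t ht
        have ht' := hsub hj ht
        have e : 1 * g (x (j + 1)) - a (x (j + 1)) * w' t - ε * w'' t
            = -(g t - g (x (j + 1))) + (a t - a (x (j + 1))) * w' t := by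
          linarith [hode t ht']
        rw [e]
        refine (abs_add_le _ _).trans (add_le_add ?_ ?_)
        · rw [abs_neg, mul_one]; exact hgc (j + 1) hj t ht
        · rw [abs_mul]
          exact mul_le_mul (hac (j + 1) hj t ht) (hwM t ht') (abs_nonneg _)
            (mul_nonneg hA hHj.le)
    have h2 : |(H j - H (j + 1)) / H (j + 1) / 2 * (H (j + 1) * g (x (j + 1))
          - a (x (j + 1)) * (w (x (j + 2)) - w (x (j + 1))))| ≤ σ j / 2 * ((G + A) * δ) := by
      rw [abs_mul, abs_div, abs_div, abs_of_pos hHj, abs_two, abs_sub_comm (H j)]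
      refine mul_le_mul_of_nonneg_left ?_ (by positivity)
      refine (abs_sub _ _).trans ?_
      rw [abs_mul, abs_mul, abs_of_pos hHj, abs_of_nonneg (hα.le.trans (haα _ hxj)), add_mul]
      refine add_le_add ?_ ?_
      · rw [mul_comm]
        exact mul_le_mul (hgG _ hxj) (hHδ _ hj) hHj.le hG
      · exact mul_le_mul (haA _ hxj) ((hwc _ hj).trans (hMδ _ hj)) (abs_nonneg _) hA
    rw [hdec]
    refine (abs_add_le _ _).trans (add_le_add (h1.trans ?_) h2)
    refine mul_le_mul_of_nonneg_right (hHδ _ hj) ?_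
    have := hMg0 (j + 1) hj
    have := mul_nonneg hA (hM0 (j + 1) hj)
    linarith
  have hrS : ∑ j ∈ Finset.range (N - 1), |r j| ≤ ((1 + A) * D + (G + A)) * δ := by
    have hlen : N - 1 + 1 = N := Nat.sub_add_cancel hx.pos
    have htel : ∀ F : ℝ → ℝ, 0 ≤ F (x 1) - F (x 0) →
        ∑ j ∈ Finset.range (N - 1), (F (x (j + 2)) - F (x (j + 1))) ≤ F 1 - F 0 := by
      intro F hF
      have := Finset.sum_range_sub (fun j => F (x (j + 1))) (N - 1)
      simp only [add_assoc, one_add_one_eq_two, zero_add] at this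
      rw [this, hlen, hx.last]
      rw [hx.zero] at hF
      linarith
    have h1 := htel M (hM0 0 hx.pos)
    have h2 := htel Mg (hMg0 0 hx.pos)
    calc ∑ j ∈ Finset.range (N - 1), |r j|
        ≤ ∑ j ∈ Finset.range (N - 1),
          (δ * ((Mg (x (j + 2)) - Mg (x (j + 1))) + A * (M (x (j + 2)) - M (x (j + 1))))
            + σ j / 2 * ((G + A) * δ)) :=
          Finset.sum_le_sum fun j hj => hr j (by have := Finset.mem_range.1 hj; omega)
      _ = δ * (∑ j ∈ Finset.range (N - 1), (Mg (x (j + 2)) - Mg (x (j + 1)))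
            + A * ∑ j ∈ Finset.range (N - 1), (M (x (j + 2)) - M (x (j + 1))))
          + (∑ j ∈ Finset.range (N - 1), σ j) / 2 * ((G + A) * δ) := by
          rw [Finset.sum_add_distrib, ← Finset.mul_sum, Finset.sum_add_distrib, ← Finset.mul_sum,
            ← Finset.sum_mul, ← Finset.sum_div]
      _ ≤ δ * (D + A * D) + 2 / 2 * ((G + A) * δ) := by
          gcongr
          · exact h2.trans hMgD
          · exact h1.trans hMD
      _ = ((1 + A) * D + (G + A)) * δ := by ring
  obtain ⟨p₁, hp₁, hb₁⟩ := exists_recurrence_of_summable_data (a := fun j => a (x j)) hε hα hH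
    (fun j hj => haα _ (hx.mem_Icc hj)) hrS
  obtain ⟨p₂, hp₂, hb₂⟩ := exists_recurrence_of_flux_data (a := fun j => a (x j)) hε hα hA hH
    (fun j hj => haα _ (hx.mem_Icc hj))
    (fun j hj => hac j hj _ (right_mem_Icc.2 (hlt j hj).le))
    (fun n hn => (hHsum n).trans_le (hx.mem_Icc hn).2) hσ hx.pos hq
  refine ⟨fun n => ∑ j ∈ Finset.range n, H j * (p₁ j + p₂ j), by simp, ?_, ?_⟩
  · intro j hj
    have h1 := hp₁ j hj
    have h2 := hp₂ j hj
    have hH0 := hH j (by omega)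
    have hH1 := hH (j + 1) hj
    have hη : ∀ i < N, Dp x (fun n => ∑ j ∈ Finset.range n, H j * (p₁ j + p₂ j)) i
        = p₁ i + p₂ i := by
      intro i hi
      have := (hH i hi).ne'
      simp only [Dp, Finset.sum_range_succ, ← hHdef]
      field_simp
      ring
    rw [delta2_succ, delta2_succ, hη _ hj, hη j (by omega)]
    simp only [Dp, add_assoc, one_add_one_eq_two, q, r] at h1 h2 ⊢
    have e2 : x (j + 2) - x j = H j + H (j + 1) := by simp only [hHdef]; ring
    have e1 : x (j + 2) - x (j + 1) = H (j + 1) := rfl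
    have e0 : x (j + 1) - x j = H j := rfl
    rw [e2, e1, e0]
    generalize H j = h₀ at *
    generalize H (j + 1) = h₁ at *
    generalize (w (x (j + 2)) - w (x (j + 1))) / h₁ = d₁ at *
    generalize (w (x (j + 1)) - w (x j)) / h₀ = d₀ at *
    have hc : (h₀ + h₁) / 2 ≠ 0 := by positivity
    generalize (h₀ + h₁) / 2 = c at *
    field_simp
    linarith
  · intro n hn
    have : ∑ j ∈ Finset.range n, H j * (p₁ j + p₂ j)
        = ∑ j ∈ Finset.range n, H j * p₁ j + ∑ j ∈ Finset.range n, H j * p₂ j := by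
      rw [← Finset.sum_add_distrib]
      exact Finset.sum_congr rfl fun j _ => mul_add _ _ _
    simp only [this]
    refine (abs_add_le _ _).trans ((add_le_add (hb₁ n hn) (hb₂ n hn)).trans_eq ?_)
    ring

/-! ### Maximum principles for the coupled system -/

/-- One-sided discrete maximum principle for the upwind system. -/
lemma discrete_system_le {N : ℕ} {x : ℕ → ℝ} (hx : ∀ j < N, x j < x (j + 1))
    {ε₁ ε₂ β B F : ℝ} (hε₁ : 0 < ε₁) (hε₂ : 0 < ε₂) (hβ : 0 < β) (hB : 0 ≤ B) (hF : 0 ≤ F)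
    {a₁ a₂ b₁₁ b₁₂ b₂₁ b₂₂ : ℝ → ℝ}
    (ha₁ : ∀ j ≤ N, 0 ≤ a₁ (x j)) (ha₂ : ∀ j ≤ N, 0 ≤ a₂ (x j))
    (hb₁ : ∀ j ≤ N, β ≤ b₁₁ (x j) - b₁₂ (x j)) (hb₂ : ∀ j ≤ N, β ≤ b₂₂ (x j) - b₂₁ (x j))
    (hb₁₂ : ∀ j ≤ N, 0 ≤ b₁₂ (x j)) (hb₂₁ : ∀ j ≤ N, 0 ≤ b₂₁ (x j))
    {U V : ℕ → ℝ} (hU₀ : U 0 ≤ B) (hV₀ : V 0 ≤ B) (hU : U N ≤ B) (hV : V N ≤ B)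
    (hL₁ : ∀ j, j + 1 < N → -F ≤ LN1 ε₁ a₁ b₁₁ b₁₂ x U V (j + 1))
    (hL₂ : ∀ j, j + 1 < N → -F ≤ LN2 ε₂ a₂ b₂₂ b₂₁ x U V (j + 1)) :
    ∀ j ≤ N, U j ≤ B + F / β ∧ V j ≤ B + F / β := by
  have hFβ : 0 ≤ F / β := by positivity
  -- a component attaining the maximum of both cannot exceed the bound
  have key : ∀ (ε : ℝ) (a b c P Q : ℕ → ℝ), 0 < ε → (∀ j ≤ N, 0 ≤ a j) →
      (∀ j ≤ N, β ≤ b j - c j) → (∀ j ≤ N, 0 ≤ c j) → P 0 ≤ B → P N ≤ B →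
      (∀ j, j + 1 < N → -F ≤ ε * delta2 x P (j + 1) + a (j + 1) * Dp x P (j + 1)
        - b (j + 1) * P (j + 1) + c (j + 1) * Q (j + 1)) →
      ∀ k ≤ N, (∀ j ≤ N, P j ≤ P k) → (∀ j ≤ N, Q j ≤ P k) → P k ≤ B + F / β := by
    intro ε a b c P Q hε ha hb hc hP0 hPN hL k hk hPk hQk
    by_contra! hlt
    rcases k with _ | k
    · linarith
    rcases hk.lt_or_eq with hkN | rfl
    swap
    · linarith
    have h0 := hx k (by omega)
    have h1 := hx (k + 1) hkN
    have hD1 : Dp x P (k + 1) ≤ 0 :=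
      div_nonpos_of_nonpos_of_nonneg (by linarith [hPk (k + 1 + 1) hkN]) (by linarith)
    have hD0 : 0 ≤ Dp x P k := div_nonneg (by linarith [hPk k (by omega)]) (by linarith)
    have hδ : delta2 x P (k + 1) ≤ 0 := by
      rw [delta2_succ]
      refine div_nonpos_of_nonpos_of_nonneg (by linarith) ?_
      have : x (k + 2) = x (k + 1 + 1) := rfl
      linarith
    have t1 := mul_nonpos_of_nonneg_of_nonpos hε.le hδ
    have t2 := mul_nonpos_of_nonneg_of_nonpos (ha (k + 1) hk) hD1
    have t3 := mul_le_mul_of_nonneg_left (hQk (k + 1) hk) (hc (k + 1) hk)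
    have hPpos : 0 ≤ P (k + 1) := by linarith
    have t4 := mul_le_mul_of_nonneg_right (hb (k + 1) hk) hPpos
    have t5 : β * (B + F / β) < β * P (k + 1) := mul_lt_mul_of_pos_left hlt hβ
    have t6 : β * (B + F / β) = β * B + F := by field_simp
    have t7 : 0 ≤ β * B := by positivity
    linarith [hL k hkN]
  obtain ⟨k, hk, hkmax⟩ := Finset.exists_max_image (Finset.range (N + 1))
    (fun j => max (U j) (V j)) ⟨0, by simp⟩
  simp only [Finset.mem_range, Nat.lt_succ_iff] at hk hkmax
  have hmaxle : max (U k) (V k) ≤ B + F / β := by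
    rcases le_total (V k) (U k) with h | h
    · simp only [max_eq_left h] at hkmax ⊢
      exact key ε₁ (fun j => a₁ (x j)) (fun j => b₁₁ (x j)) (fun j => b₁₂ (x j)) U V hε₁ ha₁ hb₁
        hb₁₂ hU₀ hU hL₁ k hk (fun j hj => (le_max_left _ _).trans (hkmax j hj))
        (fun j hj => (le_max_right _ _).trans (hkmax j hj))
    · simp only [max_eq_right h] at hkmax ⊢
      exact key ε₂ (fun j => a₂ (x j)) (fun j => b₂₂ (x j)) (fun j => b₂₁ (x j)) V U hε₂ ha₂ hb₂
        hb₂₁ hV₀ hV hL₂ k hk (fun j hj => (le_max_right _ _).trans (hkmax j hj))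
        (fun j hj => (le_max_left _ _).trans (hkmax j hj))
  exact fun j hj => max_le_iff.1 ((hkmax j hj).trans hmaxle)

lemma Dp_smul_add (x U V : ℕ → ℝ) (s t : ℝ) (j : ℕ) :
    Dp x (fun i => s * U i + t * V i) j = s * Dp x U j + t * Dp x V j := by
  simp only [Dp]; ring

lemma delta2_succ_smul_add (x U V : ℕ → ℝ) (s t : ℝ) (j : ℕ) :
    delta2 x (fun i => s * U i + t * V i) (j + 1)
      = s * delta2 x U (j + 1) + t * delta2 x V (j + 1) := by
  simp only [delta2_succ, Dp_smul_add]; ring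

/-- Stability of the upwind system in the maximum norm. -/
lemma discrete_system_abs_le {N : ℕ} {x : ℕ → ℝ} (hx : ∀ j < N, x j < x (j + 1))
    {ε₁ ε₂ β B F : ℝ} (hε₁ : 0 < ε₁) (hε₂ : 0 < ε₂) (hβ : 0 < β) (hB : 0 ≤ B) (hF : 0 ≤ F)
    {a₁ a₂ b₁₁ b₁₂ b₂₁ b₂₂ : ℝ → ℝ}
    (ha₁ : ∀ j ≤ N, 0 ≤ a₁ (x j)) (ha₂ : ∀ j ≤ N, 0 ≤ a₂ (x j))
    (hb₁ : ∀ j ≤ N, β ≤ b₁₁ (x j) - b₁₂ (x j)) (hb₂ : ∀ j ≤ N, β ≤ b₂₂ (x j) - b₂₁ (x j))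
    (hb₁₂ : ∀ j ≤ N, 0 ≤ b₁₂ (x j)) (hb₂₁ : ∀ j ≤ N, 0 ≤ b₂₁ (x j))
    {U V : ℕ → ℝ} (hU₀ : |U 0| ≤ B) (hV₀ : |V 0| ≤ B) (hU : |U N| ≤ B) (hV : |V N| ≤ B)
    (hL₁ : ∀ j, j + 1 < N → |LN1 ε₁ a₁ b₁₁ b₁₂ x U V (j + 1)| ≤ F)
    (hL₂ : ∀ j, j + 1 < N → |LN2 ε₂ a₂ b₂₂ b₂₁ x U V (j + 1)| ≤ F) :
    ∀ j ≤ N, |U j| ≤ B + F / β ∧ |V j| ≤ B + F / β := by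
  have key : ∀ s : ℝ, |s| = 1 → ∀ j ≤ N, s * U j ≤ B + F / β ∧ s * V j ≤ B + F / β := by
    intro s hs
    have hle : ∀ {y C : ℝ}, |y| ≤ C → s * y ≤ C := fun h =>
      (le_abs_self _).trans (by rwa [abs_mul, hs, one_mul])
    have hge : ∀ {y C : ℝ}, |y| ≤ C → -C ≤ s * y := fun h =>
      (neg_le_neg (by rwa [abs_mul, hs, one_mul])).trans (neg_abs_le _)
    refine discrete_system_le hx hε₁ hε₂ hβ hB hF ha₁ ha₂ hb₁ hb₂ hb₁₂ hb₂₁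
      (U := fun j => s * U j) (V := fun j => s * V j)
      (hle hU₀) (hle hV₀) (hle hU) (hle hV) ?_ ?_
    · intro j hj
      refine (hge (hL₁ j hj)).trans_eq ?_
      have h1 := delta2_succ_smul_add x U U s 0 j
      have h2 := Dp_smul_add x U U s 0 (j + 1)
      simp only [zero_mul, add_zero] at h1 h2
      simp only [LN1, h1, h2]
      ring
    · intro j hj
      refine (hge (hL₂ j hj)).trans_eq ?_
      have h1 := delta2_succ_smul_add x V V s 0 j
      have h2 := Dp_smul_add x V V s 0 (j + 1)
      simp only [zero_mul, add_zero] at h1 h2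
      simp only [LN2, h1, h2]
      ring
  intro j hj
  have h1 := key 1 (by simp) j hj
  have h2 := key (-1) (by simp) j hj
  constructor <;> rw [abs_le] <;> constructor <;> linarith [h1.1, h1.2, h2.1, h2.2]

/-- One-sided maximum principle for the continuous system. -/
lemma continuous_system_le {ε₁ ε₂ B : ℝ} (hε₁ : 0 < ε₁) (hε₂ : 0 < ε₂) (hB : 0 ≤ B)
    {a₁ a₂ b₁₁ b₁₂ b₂₁ b₂₂ : ℝ → ℝ}
    (hb₁ : ∀ x ∈ Icc (0 : ℝ) 1, 0 < b₁₁ x - b₁₂ x) (hb₂ : ∀ x ∈ Icc (0 : ℝ) 1, 0 < b₂₂ x - b₂₁ x)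
    (hb₁₂ : ∀ x ∈ Icc (0 : ℝ) 1, 0 ≤ b₁₂ x) (hb₂₁ : ∀ x ∈ Icc (0 : ℝ) 1, 0 ≤ b₂₁ x)
    {u v : ℝ → ℝ} (hu : Continuous u) (hv : Continuous v)
    (hode : ∀ x ∈ Ioo (0 : ℝ) 1,
      ε₁ * deriv (deriv u) x + a₁ x * deriv u x - b₁₁ x * u x + b₁₂ x * v x = 0 ∧
      ε₂ * deriv (deriv v) x + a₂ x * deriv v x - b₂₂ x * v x + b₂₁ x * u x = 0)
    (hu₀ : u 0 ≤ B) (hv₀ : v 0 ≤ B) (hu₁ : u 1 ≤ B) (hv₁ : v 1 ≤ B) :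
    ∀ x ∈ Icc (0 : ℝ) 1, u x ≤ B ∧ v x ≤ B := by
  have key : ∀ (ε : ℝ) (a b c p q : ℝ → ℝ), 0 < ε → (∀ x ∈ Icc (0 : ℝ) 1, 0 < b x - c x) →
      (∀ x ∈ Icc (0 : ℝ) 1, 0 ≤ c x) → Continuous p → p 0 ≤ B → p 1 ≤ B →
      (∀ x ∈ Ioo (0 : ℝ) 1, ε * deriv (deriv p) x + a x * deriv p x - b x * p x + c x * q x = 0) →
      ∀ y ∈ Icc (0 : ℝ) 1, (∀ x ∈ Icc (0 : ℝ) 1, p x ≤ p y) → (∀ x ∈ Icc (0 : ℝ) 1, q x ≤ p y) →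
      p y ≤ B := by
    intro ε a b c p q hε hb hc hp hp0 hp1 hL y hy hpy hqy
    by_contra! hlt
    have hy0 : 0 < y := hy.1.lt_of_ne (by rintro rfl; linarith)
    have hy1 : y < 1 := hy.2.lt_of_ne (by rintro rfl; linarith)
    have hmax : IsLocalMax p y := by
      filter_upwards [Icc_mem_nhds hy0 hy1] with x hx using hpy x hx
    have h2 := mul_nonpos_of_nonneg_of_nonpos hε.le (hmax.secondDeriv_nonpos hp.continuousAt)
    have h3 := hL y ⟨hy0, hy1⟩
    rw [hmax.deriv_eq_zero] at h3
    have h4 := mul_le_mul_of_nonneg_left (hqy y hy) (hc y hy)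
    have h5 := mul_pos (hb y hy) (hB.trans_lt hlt)
    linarith
  obtain ⟨y, hy, hmax⟩ := isCompact_Icc.exists_isMaxOn (nonempty_Icc.2 zero_le_one)
    (hu.max hv).continuousOn (s := Icc (0 : ℝ) 1)
  have hmax' : ∀ x ∈ Icc (0 : ℝ) 1, max (u x) (v x) ≤ max (u y) (v y) := fun x hx => hmax hx
  have hyB : max (u y) (v y) ≤ B := by
    rcases le_total (v y) (u y) with h | h
    · simp only [max_eq_left h] at hmax' ⊢
      exact key ε₁ a₁ b₁₁ b₁₂ u v hε₁ hb₁ hb₁₂ hu hu₀ hu₁ (fun x hx => (hode x hx).1) y hy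
        (fun x hx => (le_max_left _ _).trans (hmax' x hx))
        (fun x hx => (le_max_right _ _).trans (hmax' x hx))
    · simp only [max_eq_right h] at hmax' ⊢
      exact key ε₂ a₂ b₂₂ b₂₁ v u hε₂ hb₂ hb₂₁ hv hv₀ hv₁ (fun x hx => (hode x hx).2) y hy
        (fun x hx => (le_max_right _ _).trans (hmax' x hx))
        (fun x hx => (le_max_left _ _).trans (hmax' x hx))
  exact fun x hx => max_le_iff.1 ((hmax' x hx).trans hyB)

/-- Maximum principle for the continuous system. -/
lemma continuous_system_abs_le {ε₁ ε₂ B : ℝ} (hε₁ : 0 < ε₁) (hε₂ : 0 < ε₂)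
    {a₁ a₂ b₁₁ b₁₂ b₂₁ b₂₂ : ℝ → ℝ}
    (hb₁ : ∀ x ∈ Icc (0 : ℝ) 1, 0 < b₁₁ x - b₁₂ x) (hb₂ : ∀ x ∈ Icc (0 : ℝ) 1, 0 < b₂₂ x - b₂₁ x)
    (hb₁₂ : ∀ x ∈ Icc (0 : ℝ) 1, 0 ≤ b₁₂ x) (hb₂₁ : ∀ x ∈ Icc (0 : ℝ) 1, 0 ≤ b₂₁ x)
    {u v : ℝ → ℝ} (hu : Continuous u) (hv : Continuous v)
    (hode : ∀ x ∈ Ioo (0 : ℝ) 1,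
      ε₁ * deriv (deriv u) x + a₁ x * deriv u x - b₁₁ x * u x + b₁₂ x * v x = 0 ∧
      ε₂ * deriv (deriv v) x + a₂ x * deriv v x - b₂₂ x * v x + b₂₁ x * u x = 0)
    (hu₀ : |u 0| ≤ B) (hv₀ : |v 0| ≤ B) (hu₁ : |u 1| ≤ B) (hv₁ : |v 1| ≤ B) :
    ∀ x ∈ Icc (0 : ℝ) 1, |u x| ≤ B ∧ |v x| ≤ B := by
  have hB : 0 ≤ B := (abs_nonneg _).trans hu₀
  have h1 := continuous_system_le hε₁ hε₂ hB hb₁ hb₂ hb₁₂ hb₂₁ hu hv hode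
    (abs_le.1 hu₀).2 (abs_le.1 hv₀).2 (abs_le.1 hu₁).2 (abs_le.1 hv₁).2
  have h2 := continuous_system_le (a₁ := a₁) (a₂ := a₂) hε₁ hε₂ hB hb₁ hb₂ hb₁₂ hb₂₁ hu.neg hv.neg
    (fun x hx => by
      have hn : ∀ f : ℝ → ℝ, deriv (-f) = -deriv f := fun f => deriv.neg'
      have h := hode x hx
      simp only [hn, Pi.neg_apply]
      constructor <;> linarith [h.1, h.2])
    (neg_le.1 (abs_le.1 hu₀).1) (neg_le.1 (abs_le.1 hv₀).1)
    (neg_le.1 (abs_le.1 hu₁).1) (neg_le.1 (abs_le.1 hv₁).1)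
  intro x hx
  have h3 := h1 x hx
  have h4 := h2 x hx
  simp only [Pi.neg_apply] at h4
  constructor <;> rw [abs_le] <;> constructor <;> linarith [h3.1, h3.2, h4.1, h4.2]

/-! ### The boundary layer -/

/-- First-derivative bound for a bounded solution of `ε w'' + a w' = g`. -/
lemma abs_deriv_le_layer {ε α A G B : ℝ} (hε : 0 < ε) (hε1 : ε ≤ 1) (hα : 0 < α) (hG : 0 ≤ G)
    (hA : 0 ≤ A) {a a' w w' w'' g : ℝ → ℝ}
    (ha : ∀ t ∈ Icc (0 : ℝ) 1, HasDerivAt a (a' t) t)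
    (haα : ∀ t ∈ Icc (0 : ℝ) 1, α ≤ a t) (haA : ∀ t ∈ Icc (0 : ℝ) 1, |a t| ≤ A)
    (haA' : ∀ t ∈ Icc (0 : ℝ) 1, |a' t| ≤ A)
    (hw : ∀ t ∈ Icc (0 : ℝ) 1, HasDerivAt w (w' t) t)
    (hw' : ∀ t ∈ Icc (0 : ℝ) 1, HasDerivAt w' (w'' t) t)
    (hode : ∀ t ∈ Icc (0 : ℝ) 1, ε * w'' t + a t * w' t = g t)
    (hgG : ∀ t ∈ Icc (0 : ℝ) 1, |g t| ≤ G) (hwB : ∀ t ∈ Icc (0 : ℝ) 1, |w t| ≤ B) :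
    ∀ t ∈ Icc (0 : ℝ) 1, |w' t| ≤
      (2 * B + 3 * (A * B) + G + (G + 1) / α) * (1 + Real.exp (-(α / ε) * t) / ε) := by
  have hI0 : (0 : ℝ) ∈ Icc (0 : ℝ) 1 := by simp
  have hB : 0 ≤ B := (abs_nonneg _).trans (hwB 0 hI0)
  have haw : ∀ t ∈ Icc (0 : ℝ) 1, |a t * w t| ≤ A * B := fun t ht => by
    rw [abs_mul]; exact mul_le_mul (haA t ht) (hwB t ht) (abs_nonneg _) hA
  have h0 : ε * |w' 0| ≤ 2 * B + 3 * (A * B) + G := by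
    have hsub : ∀ t ∈ Icc (0 : ℝ) ε, t ∈ Icc (0 : ℝ) 1 := fun t ht => ⟨ht.1, ht.2.trans hε1⟩
    obtain ⟨c, hc, hcw⟩ := exists_hasDerivAt_eq_slope w w' hε
      (fun t ht => (hw t (hsub t ht)).continuousAt.continuousWithinAt)
      (fun t ht => hw t (hsub t (Ioo_subset_Icc_self ht)))
    have hc1 := hsub c (Ioo_subset_Icc_self hc)
    have h1 := abs_sub_le_sub_of_abs_deriv_le (f := fun t => ε * w' t + a t * w t)
      (f' := fun t => ε * w'' t + (a' t * w t + a t * w' t)) (M := fun t => (G + A * B) * t)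
      (M' := fun _ => (G + A * B) * 1) hc1.1
      (fun t ht => ((hw' t ⟨ht.1, ht.2.trans hc1.2⟩).const_mul ε).add
        ((ha t ⟨ht.1, ht.2.trans hc1.2⟩).mul (hw t ⟨ht.1, ht.2.trans hc1.2⟩)))
      (fun t _ => (hasDerivAt_id t).const_mul _) ?_
    · have h2 : ε * |w' c| ≤ 2 * B := by
        have h3 : ε * |w' c| = |w ε - w 0| := by
          rw [hcw, sub_zero, abs_div, abs_of_pos hε]; field_simp
        rw [h3]
        refine (abs_sub _ _).trans ?_
        linarith [hwB ε ⟨hε.le, hε1⟩, hwB 0 hI0]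
      have h4 : (G + A * B) * c ≤ (G + A * B) * 1 :=
        mul_le_mul_of_nonneg_left hc1.2 (by positivity)
      have h5 : ε * w' 0 = (ε * w' c + a c * w c) - a 0 * w 0
          - ((ε * w' c + a c * w c) - (ε * w' 0 + a 0 * w 0)) := by ring
      have h6 : |ε * w' 0| ≤ (2 * B + A * B) + A * B + (G + A * B) := by
        rw [h5]
        refine (abs_sub _ _).trans (add_le_add ((abs_sub _ _).trans (add_le_add
          ((abs_add_le _ _).trans (add_le_add ?_ (haw c hc1))) (haw 0 hI0))) ?_)
        · rwa [abs_mul, abs_of_pos hε]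
        · exact h1.trans (by linarith)
      rw [abs_mul, abs_of_pos hε] at h6
      linarith
    · intro t ht
      have ht' : t ∈ Icc (0 : ℝ) 1 := ⟨ht.1, ht.2.trans hc1.2⟩
      have e : ε * w'' t + (a' t * w t + a t * w' t) = g t + a' t * w t := by
        linarith [hode t ht']
      rw [e, mul_one]
      refine (abs_add_le _ _).trans (add_le_add (hgG t ht') ?_)
      rw [abs_mul]
      exact mul_le_mul (haA' t ht') (hwB t ht') (abs_nonneg _) hA
  have hup := le_exp_decay_of_linear_ode hε hα hG hw' haα
    (fun t ht => (le_abs_self _).trans (hgG t ht)) hode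
  have hdown := le_exp_decay_of_linear_ode (v := fun t => -w' t) (v' := fun t => -w'' t)
    (g := fun t => -g t) hε hα hG (fun t ht => (hw' t ht).neg) haα
    (fun t ht => (neg_le_abs _).trans (hgG t ht)) (fun t ht => by linarith [hode t ht])
  intro t ht
  have h1 := hup t ht
  have h2 := hdown t ht
  rw [abs_neg] at h2
  have hE : 0 < Real.exp (-(α / ε) * t) := Real.exp_pos _
  have h3 : |w' 0| * Real.exp (-(α / ε) * t)
      ≤ (2 * B + 3 * (A * B) + G) * (Real.exp (-(α / ε) * t) / ε) := by
    rw [mul_div_assoc', le_div_iff₀ hε]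
    calc |w' 0| * Real.exp (-(α / ε) * t) * ε = (ε * |w' 0|) * Real.exp (-(α / ε) * t) := by ring
      _ ≤ _ := by gcongr
  have h4 : |w' t| ≤ |w' 0| * Real.exp (-(α / ε) * t) + (G + 1) / α := by
    rw [abs_le]; constructor <;> linarith
  have h5 : 0 ≤ (G + 1) / α * (Real.exp (-(α / ε) * t) / ε) := by positivity
  have h6 : 0 ≤ 2 * B + 3 * (A * B) + G := by positivity
  linarith

lemma hasDerivAt_layer {α ε : ℝ} (hα : α ≠ 0) (K t : ℝ) :
    HasDerivAt (fun t => K * (t - Real.exp (-(α / ε) * t) / α))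
      (K * (1 + Real.exp (-(α / ε) * t) / ε)) t := by
  have h := (((hasDerivAt_id t).sub
    ((((hasDerivAt_id t).const_mul (-(α / ε))).exp).div_const α)).const_mul K)
  refine h.congr_deriv ?_
  simp only [id]
  field_simp
  ring

/-- The increment of a layer function over an interval that is either short or outside the
layer. -/
lemma exp_layer_sub_le {α ε u v : ℝ} {N : ℕ} (hN : 0 < N) (hα : 0 < α) (hε : 0 < ε)
    (hln : 1 ≤ Real.log N) (hu : 0 ≤ u) (huv : u ≤ v)
    (h : v - u ≤ 4 * (2 * ε / α * Real.log N) / N ∨ 2 * ε / α * Real.log N ≤ u) :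
    Real.exp (-(α / ε) * u) - Real.exp (-(α / ε) * v) ≤ 8 * (Real.log N / N) := by
  have hNR : (0 : ℝ) < N := Nat.cast_pos.2 hN
  rcases h with h | h
  · have h1 : Real.exp (-(α / ε) * u) ≤ 1 := Real.exp_le_one_iff.2 (by
      have : 0 ≤ α / ε * u := by positivity
      linarith)
    have h2 : Real.exp (-(α / ε) * v)
        = Real.exp (-(α / ε) * u) * Real.exp (-(α / ε) * (v - u)) := by
      rw [← Real.exp_add]; ring_nf
    have h3 := Real.add_one_le_exp (-(α / ε) * (v - u))
    have h4 : α / ε * (v - u) ≤ 8 * (Real.log N / N) := by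
      calc α / ε * (v - u) ≤ α / ε * (4 * (2 * ε / α * Real.log N) / N) := by gcongr
        _ = 8 * (Real.log N / N) := by field_simp; norm_num
    have h5 : 0 ≤ α / ε * (v - u) := mul_nonneg (by positivity) (by linarith)
    rw [h2]
    nlinarith [Real.exp_pos (-(α / ε) * u)]
  · have h1 : Real.exp (-(α / ε) * u) ≤ Real.exp (-Real.log N) := by
      refine Real.exp_le_exp.2 ?_
      have h2 : α / ε * (2 * ε / α * Real.log N) ≤ α / ε * u := by gcongr
      have h3 : α / ε * (2 * ε / α * Real.log N) = 2 * Real.log N := by field_simp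
      linarith
    have h2 : Real.exp (-Real.log N) = 1 / N := by rw [Real.exp_neg, Real.exp_log hNR, one_div]
    have h3 : (1 : ℝ) / N ≤ Real.log N / N := by gcongr
    have h4 : 0 ≤ Real.log N / N := by positivity
    linarith [Real.exp_pos (-(α / ε) * v)]

/-! ### The Shishkin mesh -/

/-- A piecewise-uniform mesh with transition points `τ₁ ≤ τ₂ / 2` and `τ₂ ≤ 1 / 2`. -/
structure IsPiecewiseUniform (m : ℕ) (τ₁ τ₂ : ℝ) (x : ℕ → ℝ) : Prop where
  pos : 0 < m
  pos₁ : 0 < τ₁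
  le₁ : τ₁ ≤ τ₂ / 2
  le₂ : τ₂ ≤ 1 / 2
  fine : ∀ j ≤ m, x j = j * (τ₁ / m)
  middle : ∀ j, m ≤ j → j ≤ 2 * m → x j = τ₁ + (j - m) * ((τ₂ - τ₁) / m)
  coarse : ∀ j, 2 * m ≤ j → x j = τ₂ + (j - 2 * m) * ((1 - τ₂) / (2 * m))

namespace IsPiecewiseUniform

variable {m : ℕ} {τ₁ τ₂ : ℝ} {x : ℕ → ℝ}

lemma step_fine (h : IsPiecewiseUniform m τ₁ τ₂ x) {j : ℕ} (hj : j < m) :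
    x (j + 1) - x j = τ₁ / m := by
  rw [h.fine _ hj, h.fine _ hj.le]; push_cast; ring

lemma step_middle (h : IsPiecewiseUniform m τ₁ τ₂ x) {j : ℕ} (hj : m ≤ j) (hj' : j < 2 * m) :
    x (j + 1) - x j = (τ₂ - τ₁) / m := by
  rw [h.middle _ (by omega) hj', h.middle _ hj hj'.le]; push_cast; ring

lemma step_coarse (h : IsPiecewiseUniform m τ₁ τ₂ x) {j : ℕ} (hj : 2 * m ≤ j) :
    x (j + 1) - x j = (1 - τ₂) / (2 * m) := by
  rw [h.coarse _ (by omega), h.coarse _ hj]; push_cast; ring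

lemma isStepMesh (h : IsPiecewiseUniform m τ₁ τ₂ x) : IsStepMesh (4 * m) x := by
  have hm := h.pos
  have hmR : (0 : ℝ) < m := Nat.cast_pos.2 hm
  have hτ₁ := h.pos₁
  have hτ := h.le₁
  have hτ₂ := h.le₂
  have hpos : ∀ j, 0 < x (j + 1) - x j := by
    intro j
    rcases lt_or_ge j m with h1 | h1
    · rw [h.step_fine h1]; positivity
    rcases lt_or_ge j (2 * m) with h2 | h2
    · rw [h.step_middle h1 h2]; exact div_pos (by linarith) hmR
    · rw [h.step_coarse h2]; exact div_pos (by linarith) (by positivity)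
  refine ⟨by omega, by simp [h.fine 0 hm.le], ?_, fun j _ => sub_pos.1 (hpos j), ?_, ?_⟩
  · rw [h.coarse _ (by omega)]; push_cast; field_simp; ring
  · intro j _
    have e : (2 : ℝ) / ((4 * m : ℕ) : ℝ) = (1 / 2) / m := by push_cast; field_simp; norm_num
    rw [e]
    rcases lt_or_ge j m with h1 | h1
    · rw [h.step_fine h1]; gcongr; linarith
    rcases lt_or_ge j (2 * m) with h2 | h2
    · rw [h.step_middle h1 h2]; gcongr; linarith
    · rw [h.step_coarse h2, ← div_div]; gcongr; linarith
  · have hle : ∀ j ∈ Finset.range (4 * m - 1),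
        |(x (j + 2) - x (j + 1)) - (x (j + 1) - x j)| / (x (j + 2) - x (j + 1))
          ≤ (if j = m - 1 then 1 else 0) + (if j = 2 * m - 1 then 1 else 0) := by
      intro j _
      have hj1 : 0 < x (j + 2) - x (j + 1) := hpos (j + 1)
      have hratio : ∀ {u v : ℝ}, 0 < u → u ≤ 2 * v → |v - u| / v ≤ 1 := by
        intro u v hu huv
        rw [div_le_one (by linarith), abs_le]
        constructor <;> linarith
      have hzero : x (j + 2) - x (j + 1) = x (j + 1) - x j →
          |(x (j + 2) - x (j + 1)) - (x (j + 1) - x j)| / (x (j + 2) - x (j + 1)) = 0 := by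
        intro e; rw [e]; simp
      rcases lt_trichotomy j (m - 1) with h1 | h1 | h1
      · have := hzero ((h.step_fine (by omega : j + 1 < m)).trans
          (h.step_fine (by omega : j < m)).symm)
        rw [this]; positivity
      · have e1 : x (j + 2) - x (j + 1) = (τ₂ - τ₁) / m := h.step_middle (by omega) (by omega)
        have e0 := h.step_fine (by omega : j < m)
        rw [if_pos h1, if_neg (by omega), e1, e0, add_zero]
        refine hratio (by positivity) ?_
        rw [mul_div_assoc']
        gcongr
        linarith
      rcases lt_trichotomy j (2 * m - 1) with h2 | h2 | h2
      · have := hzero ((h.step_middle (by omega : m ≤ j + 1) (by omega)).trans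
          (h.step_middle (by omega : m ≤ j) (by omega)).symm)
        rw [this]; positivity
      · have e1 : x (j + 2) - x (j + 1) = (1 - τ₂) / (2 * m) := h.step_coarse (by omega)
        have e0 := h.step_middle (by omega : m ≤ j) (by omega)
        rw [if_neg (by omega), if_pos h2, e1, e0, zero_add]
        refine hratio (div_pos (by linarith) hmR) ?_
        rw [mul_div_assoc', mul_div_mul_left _ _ two_ne_zero]
        exact (div_le_div_iff_of_pos_right hmR).2 (by linarith)
      · have := hzero ((h.step_coarse (by omega : 2 * m ≤ j + 1)).trans
          (h.step_coarse (by omega : 2 * m ≤ j)).symm)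
        rw [this]; positivity
    refine (Finset.sum_le_sum hle).trans ?_
    rw [Finset.sum_add_distrib, Finset.sum_ite_eq', Finset.sum_ite_eq']
    split_ifs <;> norm_num

end IsPiecewiseUniform

lemma shMesh_isPiecewiseUniform {m : ℕ} (hm : 0 < m) {α ε₁ ε₂ : ℝ} (hα : 0 < α) (hε₁ : 0 < ε₁)
    (hε₂ : 0 < ε₂) :
    IsPiecewiseUniform m
      (min (min (1 / 2) (2 * ε₂ / α * Real.log (4 * m : ℕ)) / 2)
        (2 * ε₁ / α * Real.log (4 * m : ℕ)))
      (min (1 / 2) (2 * ε₂ / α * Real.log (4 * m : ℕ))) (shMesh (4 * m) α ε₁ ε₂) := by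
  have hmR : (m : ℝ) ≠ 0 := by positivity
  have hlog : 0 < Real.log (4 * m : ℕ) :=
    Real.log_pos (by exact_mod_cast (by omega : 1 < 4 * m))
  have h4 : 4 * m / 4 = m := by omega
  have h2 : 4 * m / 2 = 2 * m := by omega
  constructor
  · exact hm
  · positivity
  · exact min_le_left _ _
  · exact min_le_left _ _
  all_goals
    simp only [shMesh, h4, h2]
    generalize min (1 / 2 : ℝ) (2 * ε₂ / α * Real.log (4 * m : ℕ)) = τ₂
    generalize min (τ₂ / 2 : ℝ) (2 * ε₁ / α * Real.log (4 * m : ℕ)) = τ₁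
    push_cast
  · intro j hj
    rw [if_pos hj]; field_simp
  · intro j hj hj'
    rcases hj.eq_or_lt with rfl | hj
    · rw [if_pos le_rfl]; field_simp; ring
    · rw [if_neg (by omega), if_pos hj']; field_simp
  · intro j hj
    rcases hj.eq_or_lt with rfl | hj
    · rw [if_neg (by omega), if_pos le_rfl]; push_cast; field_simp; ring
    · rw [if_neg (by omega), if_neg (by omega)]; field_simp; ring

/-- Every cell of the Shishkin mesh is either short relative to the layers of both components or
lies outside the respective layer. -/
lemma shMesh_cell {m : ℕ} (hm : 0 < m) {α ε₁ ε₂ : ℝ} (hα : 0 < α) (hε₁ : 0 < ε₁) (h12 : ε₁ < ε₂)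
    {ε : ℝ} (hε : ε = ε₁ ∨ ε = ε₂) {j : ℕ} (hj : j < 4 * m) :
    shMesh (4 * m) α ε₁ ε₂ (j + 1) - shMesh (4 * m) α ε₁ ε₂ j
        ≤ 4 * (2 * ε / α * Real.log (4 * m : ℕ)) / (4 * m : ℕ)
      ∨ 2 * ε / α * Real.log (4 * m : ℕ) ≤ shMesh (4 * m) α ε₁ ε₂ j := by
  have hmR : (0 : ℝ) < m := Nat.cast_pos.2 hm
  have hlog : 0 < Real.log (4 * m : ℕ) :=
    Real.log_pos (by exact_mod_cast (by omega : 1 < 4 * m))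
  have hL : 2 * ε₁ / α * Real.log (4 * m : ℕ) < 2 * ε₂ / α * Real.log (4 * m : ℕ) := by gcongr
  have hp := shMesh_isPiecewiseUniform hm hα hε₁ (hε₁.trans h12)
  have hmesh := hp.isStepMesh
  have e : ∀ L : ℝ, 4 * L / ((4 * m : ℕ) : ℝ) = L / m := by
    intro L; push_cast; field_simp
  rw [e]
  have hLε : 2 * ε / α * Real.log (4 * m : ℕ) = 2 * ε₁ / α * Real.log (4 * m : ℕ) ∨
      2 * ε / α * Real.log (4 * m : ℕ) = 2 * ε₂ / α * Real.log (4 * m : ℕ) := by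
    rcases hε with rfl | rfl <;> simp
  generalize 2 * ε / α * Real.log (4 * m : ℕ) = L at *
  generalize 2 * ε₁ / α * Real.log (4 * m : ℕ) = L₁ at *
  generalize 2 * ε₂ / α * Real.log (4 * m : ℕ) = L₂ at *
  generalize shMesh (4 * m) α ε₁ ε₂ = x at *
  generalize hτ₂ : min (1 / 2 : ℝ) L₂ = τ₂ at *
  generalize hτ₁ : min (τ₂ / 2) L₁ = τ₁ at *
  have hτ₁0 := hp.pos₁
  have hτ12 := hp.le₁
  have hτ₂h := hp.le₂
  have hτ₂L : τ₂ ≤ L₂ := hτ₂ ▸ min_le_right _ _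
  have hτ₁L : τ₁ ≤ L₁ := hτ₁ ▸ min_le_right _ _
  have hxm : x m = τ₁ := by rw [hp.fine m le_rfl]; field_simp
  have hx2m : x (2 * m) = τ₂ := by rw [hp.coarse _ le_rfl]; push_cast; ring
  rcases lt_or_ge j m with h1 | h1
  · left
    rw [hp.step_fine h1]
    gcongr
    rcases hLε with rfl | rfl <;> linarith
  rcases lt_or_ge j (2 * m) with h2 | h2
  · have hxj : τ₁ ≤ x j := hxm ▸ hmesh.le_of_le h1 hj.le
    rw [hp.step_middle h1 h2]
    rcases hLε with rfl | rfl
    · rcases min_choice (τ₂ / 2) L with h | h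
      · left; gcongr; linarith
      · right; linarith
    · left; gcongr; linarith
  · have hxj : τ₂ ≤ x j := hx2m ▸ hmesh.le_of_le h2 hj.le
    rw [hp.step_coarse h2]
    rcases le_or_gt L τ₂ with h | h
    · right; linarith
    · left
      have h3 : τ₂ = 1 / 2 := by
        rcases min_choice (1 / 2 : ℝ) L₂ with h' | h'
        · linarith
        · rcases hLε with h4 | h4 <;> linarith
      rw [← div_div]
      gcongr
      linarith

/-! ### The error estimate -/

lemma ContDiff.hasDerivAt_deriv {f : ℝ → ℝ} {n : WithTop ℕ∞} (hf : ContDiff ℝ n f) (hn : 1 ≤ n)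
    (t : ℝ) : HasDerivAt f (deriv f t) t :=
  (hf.differentiable (by rintro rfl; simp at hn) t).hasDerivAt

/-- A `C¹` function and its derivative are bounded on `[0,1]`. -/
lemma ContDiff.exists_bound_Icc {f : ℝ → ℝ} {n : WithTop ℕ∞} (hf : ContDiff ℝ n f) (hn : 1 ≤ n) :
    ∃ A : ℝ, ∀ t ∈ Icc (0 : ℝ) 1, |f t| ≤ A ∧ |deriv f t| ≤ A := by
  obtain ⟨A, hA⟩ := isCompact_Icc.exists_bound_of_continuousOn (s := Icc (0 : ℝ) 1)
    hf.continuous.continuousOn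
  obtain ⟨A', hA'⟩ := isCompact_Icc.exists_bound_of_continuousOn (s := Icc (0 : ℝ) 1)
    (hf.continuous_deriv hn).continuousOn
  exact ⟨max A A', fun t ht => ⟨(hA t ht).trans (le_max_left _ _),
    (hA' t ht).trans (le_max_right _ _)⟩⟩

/-- The constant in the first-derivative bound of the singular component. -/
noncomputable def layerConst (α A B : ℝ) : ℝ :=
  2 * B + 3 * (A * B) + 2 * (A * B) + (2 * (A * B) + 1) / α

/-- A bound for the total increment of the functions dominating the singular component and the
zero-order terms. -/
noncomputable def incrementConst (α A B : ℝ) : ℝ :=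
  layerConst α A B * (1 + 1 / α)
    + (2 * (A * B) + A * (2 * (layerConst α A B * (1 + 1 / α))))

/-- The constant in the bound of the truncation error corrector. -/
noncomputable def correctorConst (α A B : ℝ) : ℝ :=
  (2 / α * ((1 + A) * incrementConst α A B + (2 * (A * B) + A))
    + (2 / α + A / α ^ 2 + 2 / α * 2) * (2 * (A * B) + A))
  * (2 + layerConst α A B * (2 + 8 / α))

/-- The corrector of the upwind truncation error for one equation of the system. -/
lemma exists_component_corrector {N : ℕ} {x : ℕ → ℝ} (hx : IsStepMesh N x)
    (hN : 1 ≤ Real.log N) {ε ε' α A B : ℝ} (hε : 0 < ε) (hα : 0 < α)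
    (hA : 0 ≤ A) (hB : 0 ≤ B) {a b c w v : ℝ → ℝ}
    (ha : ContDiff ℝ 3 a) (hb : ContDiff ℝ 3 b) (hc : ContDiff ℝ 3 c)
    (hw : ContDiff ℝ 3 w) (hv : ContDiff ℝ 3 v) (haα : ∀ t ∈ Icc (0 : ℝ) 1, α ≤ a t)
    (haA : ∀ t ∈ Icc (0 : ℝ) 1, |a t| ≤ A ∧ |deriv a t| ≤ A)
    (hbA : ∀ t ∈ Icc (0 : ℝ) 1, |b t| ≤ A ∧ |deriv b t| ≤ A)
    (hcA : ∀ t ∈ Icc (0 : ℝ) 1, |c t| ≤ A ∧ |deriv c t| ≤ A)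
    (hwB : ∀ t ∈ Icc (0 : ℝ) 1, |w t| ≤ B) (hvB : ∀ t ∈ Icc (0 : ℝ) 1, |v t| ≤ B)
    (hode : ∀ t ∈ Icc (0 : ℝ) 1, ε * deriv (deriv w) t + a t * deriv w t = b t * w t - c t * v t)
    (hw' : ∀ t ∈ Icc (0 : ℝ) 1,
      |deriv w t| ≤ layerConst α A B * (1 + Real.exp (-(α / ε) * t) / ε))
    (hv' : ∀ t ∈ Icc (0 : ℝ) 1,
      |deriv v t| ≤ layerConst α A B * (1 + Real.exp (-(α / ε') * t) / ε'))
    (hcell : ∀ j < N, x (j + 1) - x j ≤ 4 * (2 * ε / α * Real.log N) / N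
      ∨ 2 * ε / α * Real.log N ≤ x j) :
    ∃ η : ℕ → ℝ, η 0 = 0 ∧
      (∀ j, j + 1 < N →
        ε * delta2 x η (j + 1) + a (x (j + 1)) * Dp x η (j + 1)
          = (b (x (j + 1)) * w (x (j + 1)) - c (x (j + 1)) * v (x (j + 1))) -
          (ε * delta2 x (fun i => w (x i)) (j + 1)
            + a (x (j + 1)) * Dp x (fun i => w (x i)) (j + 1))) ∧
      ∀ j ≤ N, |η j| ≤ correctorConst α A B * (Real.log N / N) := by
  have h13 : (1 : WithTop ℕ∞) ≤ 3 := by norm_num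
  set K := layerConst α A B with hK
  have hK0 : 0 ≤ K := by rw [hK, layerConst]; positivity
  have hNR : (0 : ℝ) < N := Nat.cast_pos.2 hx.pos
  have hinv : 1 / (N : ℝ) ≤ Real.log N / N := by gcongr
  have hwd : ContDiff ℝ 2 (deriv w) := by
    have : ContDiff ℝ (2 + 1) w := by convert hw using 1; norm_num
    exact (contDiff_succ_iff_deriv.1 this).2.2
  have hend : ∀ e : ℝ, K * (1 - Real.exp (-(α / e) * 1) / α)
      - K * (0 - Real.exp (-(α / e) * 0) / α) ≤ K * (1 + 1 / α) := by
    intro e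
    have h1 : 0 ≤ Real.exp (-(α / e) * 1) / α := by positivity
    rw [← mul_sub, mul_zero, Real.exp_zero]
    gcongr
    linarith
  have hKα : 0 ≤ K * (1 + 1 / α) := by positivity
  have hzero : ∀ {p q r s : ℝ}, |p| ≤ A → |q| ≤ B → |r| ≤ A → |s| ≤ B →
      |p * q - r * s| ≤ 2 * (A * B) := by
    intro p q r s hp hq hr hs
    refine (abs_sub _ _).trans ?_
    rw [abs_mul, abs_mul, two_mul]
    gcongr
  refine (exists_upwind_corrector hx hε hα hA (by positivity)
    (a := a) (a' := deriv a) (w := w) (w' := deriv w) (w'' := deriv (deriv w))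
    (g := fun t => b t * w t - c t * v t)
    (g' := fun t => (deriv b t * w t + b t * deriv w t) - (deriv c t * v t + c t * deriv v t))
    (M := fun t => K * (t - Real.exp (-(α / ε) * t) / α))
    (M' := fun t => K * (1 + Real.exp (-(α / ε) * t) / ε))
    (Mg := fun t => 2 * (A * B) * t + A * (K * (t - Real.exp (-(α / ε) * t) / α)
      + K * (t - Real.exp (-(α / ε') * t) / α)))
    (Mg' := fun t => 2 * (A * B) * 1 + A * (K * (1 + Real.exp (-(α / ε) * t) / ε)
      + K * (1 + Real.exp (-(α / ε') * t) / ε')))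
    (G := 2 * (A * B)) (D := incrementConst α A B) (δ := (2 + K * (2 + 8 / α)) * (Real.log N / N))
    (fun t _ => ha.hasDerivAt_deriv h13 t) haα (fun t ht => (le_abs_self _).trans (haA t ht).1)
    (fun t ht => (haA t ht).2) (fun t _ => hw.hasDerivAt_deriv h13 t)
    (fun t _ => hwd.hasDerivAt_deriv (by norm_num) t) hode
    (fun t _ => ((hb.hasDerivAt_deriv h13 t).mul (hw.hasDerivAt_deriv h13 t)).sub
      ((hc.hasDerivAt_deriv h13 t).mul (hv.hasDerivAt_deriv h13 t)))
    (fun t ht => hzero (hbA t ht).1 (hwB t ht) (hcA t ht).1 (hvB t ht))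
    (fun t _ => hasDerivAt_layer hα.ne' K t)
    (fun t _ => ((hasDerivAt_id t).const_mul _).add
      (((hasDerivAt_layer hα.ne' K t).add (hasDerivAt_layer hα.ne' K t)).const_mul A))
    hw' ?_ ?_ ?_ ?_ ?_).elim ?_
  · intro t ht
    have e : (deriv b t * w t + b t * deriv w t) - (deriv c t * v t + c t * deriv v t)
        = (deriv b t * w t - deriv c t * v t) + (b t * deriv w t - c t * deriv v t) := by ring
    rw [e, mul_one, mul_add]
    refine (abs_add_le _ _).trans (add_le_add
      (hzero (hbA t ht).2 (hwB t ht) (hcA t ht).2 (hvB t ht))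
      ((abs_sub _ _).trans (add_le_add ?_ ?_)))
    · rw [abs_mul]
      exact mul_le_mul (hbA t ht).1 (hw' t ht) (abs_nonneg _) hA
    · rw [abs_mul]
      exact mul_le_mul (hcA t ht).1 (hv' t ht) (abs_nonneg _) hA
  · refine (hend ε).trans ?_
    rw [incrementConst, ← hK]
    have : 0 ≤ 2 * (A * B) + A * (2 * (K * (1 + 1 / α))) := by positivity
    linarith
  · rw [incrementConst, ← hK]
    have h := mul_le_mul_of_nonneg_left (add_le_add (hend ε) (hend ε')) hA
    linarith
  · intro j hj
    have h1 := exp_layer_sub_le hx.pos hα hε hN (hx.mem_Icc hj.le).1 (hx.lt j hj).le (hcell j hj)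
    have h2 := hx.step_le j hj
    have h3 : (Real.exp (-(α / ε) * x j) - Real.exp (-(α / ε) * x (j + 1))) / α
        ≤ 8 * (Real.log N / N) / α := by gcongr
    have h4 : 2 / (N : ℝ) = 2 * (1 / N) := by ring
    calc _ = K * ((x (j + 1) - x j)
          + (Real.exp (-(α / ε) * x j) - Real.exp (-(α / ε) * x (j + 1))) / α) := by ring
      _ ≤ K * (2 * (Real.log N / N) + 8 * (Real.log N / N) / α) := by gcongr; linarith
      _ = K * (2 + 8 / α) * (Real.log N / N) := by ring
      _ ≤ _ := by gcongr; linarith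
  · have h4 : 2 / (N : ℝ) = 2 * (1 / N) := by ring
    have h5 : 0 ≤ K * (2 + 8 / α) * (Real.log N / N) := by positivity
    linarith
  · rintro η ⟨hη0, hηL, hηb⟩
    refine ⟨η, hη0, hηL, fun j hj => (hηb j hj).trans_eq ?_⟩
    rw [correctorConst, ← hK]
    ring

/-- Almost first-order parameter-uniform error estimate for the singular component
on the Shishkin mesh. -/
theorem singular_component_error
    (α β C₀ : ℝ) (a₁ a₂ b₁₁ b₁₂ b₂₁ b₂₂ : ℝ → ℝ)
    (hα : 0 < α) (hβ : 0 < β) (hC₀ : 0 ≤ C₀)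
    (ha₁s : ContDiff ℝ 3 a₁) (ha₂s : ContDiff ℝ 3 a₂)
    (hb₁₁s : ContDiff ℝ 3 b₁₁) (hb₁₂s : ContDiff ℝ 3 b₁₂)
    (hb₂₁s : ContDiff ℝ 3 b₂₁) (hb₂₂s : ContDiff ℝ 3 b₂₂)
    (ha₁ : ∀ x ∈ Icc (0:ℝ) 1, α ≤ a₁ x) (ha₂ : ∀ x ∈ Icc (0:ℝ) 1, α ≤ a₂ x)
    (hb₁ : ∀ x ∈ Icc (0:ℝ) 1, β ≤ b₁₁ x - b₁₂ x)
    (hb₂ : ∀ x ∈ Icc (0:ℝ) 1, β ≤ b₂₂ x - b₂₁ x)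
    (hb₁₂ : ∀ x ∈ Icc (0:ℝ) 1, 0 < b₁₂ x) (hb₂₁ : ∀ x ∈ Icc (0:ℝ) 1, 0 < b₂₁ x) :
    ∃ C : ℝ, 0 < C ∧
      ∀ ε₁ ε₂ : ℝ, 0 < ε₁ → ε₁ < ε₂ → ε₂ ≤ 1 →
      ∀ N : ℕ, 4 ≤ N → 4 ∣ N →
      ∀ w₁ w₂ : ℝ → ℝ, ContDiff ℝ 3 w₁ → ContDiff ℝ 3 w₂ →
        (∀ x ∈ Ioo (0:ℝ) 1,
          ε₁ * deriv (deriv w₁) x + a₁ x * deriv w₁ x - b₁₁ x * w₁ x + b₁₂ x * w₂ x = 0 ∧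
          ε₂ * deriv (deriv w₂) x + a₂ x * deriv w₂ x - b₂₂ x * w₂ x + b₂₁ x * w₁ x = 0) →
        w₁ 1 = 0 → w₂ 1 = 0 → max |w₁ 0| |w₂ 0| ≤ C₀ →
        ∀ W₁ W₂ : ℕ → ℝ,
          (∀ j, 1 ≤ j → j < N →
            LN1 ε₁ a₁ b₁₁ b₁₂ (shMesh N α ε₁ ε₂) W₁ W₂ j = 0 ∧
            LN2 ε₂ a₂ b₂₂ b₂₁ (shMesh N α ε₁ ε₂) W₁ W₂ j = 0) →
          W₁ 0 = w₁ 0 → W₂ 0 = w₂ 0 → W₁ N = w₁ 1 → W₂ N = w₂ 1 →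
          ∀ j ≤ N,
            |W₁ j - w₁ (shMesh N α ε₁ ε₂ j)| ≤ C * Real.log (N : ℝ) / N ∧
            |W₂ j - w₂ (shMesh N α ε₁ ε₂ j)| ≤ C * Real.log (N : ℝ) / N := by
  have h13 : (1 : WithTop ℕ∞) ≤ 3 := by norm_num
  obtain ⟨A₁, hA₁⟩ := ha₁s.exists_bound_Icc h13
  obtain ⟨A₂, hA₂⟩ := ha₂s.exists_bound_Icc h13
  obtain ⟨A₃, hA₃⟩ := hb₁₁s.exists_bound_Icc h13
  obtain ⟨A₄, hA₄⟩ := hb₁₂s.exists_bound_Icc h13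
  obtain ⟨A₅, hA₅⟩ := hb₂₁s.exists_bound_Icc h13
  obtain ⟨A₆, hA₆⟩ := hb₂₂s.exists_bound_Icc h13
  obtain ⟨A, hA⟩ : ∃ A : ℝ, A ∈ upperBounds {A₁, A₂, A₃, A₄, A₅, A₆} :=
    (Set.toFinite _).bddAbove
  simp only [upperBounds_insert, upperBounds_singleton, mem_inter_iff, mem_Ici] at hA
  obtain ⟨hA1, hA2, hA3, hA4, hA5, hA6⟩ := hA
  have weaken : ∀ {f : ℝ → ℝ} {A' : ℝ}, A' ≤ A →
      (∀ t ∈ Icc (0 : ℝ) 1, |f t| ≤ A' ∧ |deriv f t| ≤ A') →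
      ∀ t ∈ Icc (0 : ℝ) 1, |f t| ≤ A ∧ |deriv f t| ≤ A :=
    fun h hf t ht => ⟨(hf t ht).1.trans h, (hf t ht).2.trans h⟩
  replace hA₁ := weaken hA1 hA₁
  replace hA₂ := weaken hA2 hA₂
  replace hA₃ := weaken hA3 hA₃
  replace hA₄ := weaken hA4 hA₄
  replace hA₅ := weaken hA5 hA₅
  replace hA₆ := weaken hA6 hA₆
  have hA0 : 0 ≤ A := (abs_nonneg _).trans (hA₁ 0 (by simp)).1
  have hK0 : 0 ≤ layerConst α A C₀ := by rw [layerConst]; positivity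
  have hκ : 0 ≤ correctorConst α A C₀ := by
    rw [correctorConst, incrementConst]; positivity
  refine ⟨correctorConst α A C₀ * (2 + 2 * A / β) + 1, by positivity, ?_⟩
  intro ε₁ ε₂ hε₁ h12 hε₂1 N hN4 hN w₁ w₂ hw₁ hw₂ hode hw₁1 hw₂1 hw0 W₁ W₂ hW hW₁0 hW₂0 hW₁N hW₂N
  obtain ⟨m, rfl⟩ := hN
  have hm : 0 < m := by omega
  have hε₂ : 0 < ε₂ := hε₁.trans h12
  have hcell := fun ε hε j hj => shMesh_cell hm hα hε₁ h12 (ε := ε) hε (j := j) hj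
  have hx : IsStepMesh (4 * m) (shMesh (4 * m) α ε₁ ε₂) :=
    (shMesh_isPiecewiseUniform hm hα hε₁ hε₂).isStepMesh
  generalize shMesh (4 * m) α ε₁ ε₂ = x at *
  have hlog : 1 ≤ Real.log (4 * m : ℕ) := by
    rw [Real.le_log_iff_exp_le (by exact_mod_cast (by omega : 0 < 4 * m))]
    have h4 : (4 : ℝ) ≤ (4 * m : ℕ) := by exact_mod_cast hN4
    linarith [Real.exp_one_lt_d9]
  generalize 4 * m = N at *
  have hNR : (0 : ℝ) < N := Nat.cast_pos.2 hx.pos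
  -- the solution is bounded by its boundary values
  obtain ⟨hw₁0, hw₂0⟩ := max_le_iff.1 hw0
  have hwB := continuous_system_abs_le hε₁ hε₂
    (fun t ht => hβ.trans_le (hb₁ t ht)) (fun t ht => hβ.trans_le (hb₂ t ht))
    (fun t ht => (hb₁₂ t ht).le) (fun t ht => (hb₂₁ t ht).le) hw₁.continuous hw₂.continuous hode
    hw₁0 hw₂0 (by simpa [hw₁1] using hC₀) (by simpa [hw₂1] using hC₀)
  have hwd : ∀ {w : ℝ → ℝ}, ContDiff ℝ 3 w → ContDiff ℝ 2 (deriv w) := by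
    intro w hw
    have : ContDiff ℝ (2 + 1) w := by convert hw using 1; norm_num
    exact (contDiff_succ_iff_deriv.1 this).2.2
  have extend : ∀ {ε : ℝ} {a b c w v : ℝ → ℝ}, Continuous a → Continuous b → Continuous c →
      ContDiff ℝ 3 w → ContDiff ℝ 3 v →
      (∀ t ∈ Ioo (0 : ℝ) 1,
        ε * deriv (deriv w) t + a t * deriv w t - b t * w t + c t * v t = 0) →
      ∀ t ∈ Icc (0 : ℝ) 1,
        ε * deriv (deriv w) t + a t * deriv w t = b t * w t - c t * v t := by
    intro ε a b c w v ha hb hc hw hv h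
    have h1 := hw.continuous
    have h2 := hv.continuous
    have h3 := (hwd hw).continuous
    have h4 := (hwd hw).continuous_deriv (by norm_num)
    have hEq : EqOn (fun t => ε * deriv (deriv w) t + a t * deriv w t)
        (fun t => b t * w t - c t * v t) (closure (Ioo (0 : ℝ) 1)) :=
      EqOn.closure (fun t ht => by linarith [h t ht]) (by fun_prop) (by fun_prop)
    rw [closure_Ioo zero_ne_one] at hEq
    exact hEq
  have hode₁ := extend ha₁s.continuous hb₁₁s.continuous hb₁₂s.continuous hw₁ hw₂
    (fun t ht => (hode t ht).1)
  have hode₂ := extend ha₂s.continuous hb₂₂s.continuous hb₂₁s.continuous hw₂ hw₁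
    (fun t ht => (hode t ht).2)
  have hlayer : ∀ {ε : ℝ} {a b c w v : ℝ → ℝ}, 0 < ε → ε ≤ 1 → ContDiff ℝ 3 a →
      (∀ t ∈ Icc (0 : ℝ) 1, α ≤ a t) → (∀ t ∈ Icc (0 : ℝ) 1, |a t| ≤ A ∧ |deriv a t| ≤ A) →
      (∀ t ∈ Icc (0 : ℝ) 1, |b t| ≤ A ∧ |deriv b t| ≤ A) →
      (∀ t ∈ Icc (0 : ℝ) 1, |c t| ≤ A ∧ |deriv c t| ≤ A) → ContDiff ℝ 3 w →
      (∀ t ∈ Icc (0 : ℝ) 1, |w t| ≤ C₀) → (∀ t ∈ Icc (0 : ℝ) 1, |v t| ≤ C₀) →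
      (∀ t ∈ Icc (0 : ℝ) 1,
        ε * deriv (deriv w) t + a t * deriv w t = b t * w t - c t * v t) →
      ∀ t ∈ Icc (0 : ℝ) 1,
        |deriv w t| ≤ layerConst α A C₀ * (1 + Real.exp (-(α / ε) * t) / ε) := by
    intro ε a b c w v hε hε1 ha haα haA hbA hcA hw hwC hvC h
    refine abs_deriv_le_layer (G := 2 * (A * C₀)) hε hε1 hα (by positivity) hA0
      (fun t _ => ha.hasDerivAt_deriv h13 t) haα (fun t ht => (haA t ht).1)
      (fun t ht => (haA t ht).2) (fun t _ => hw.hasDerivAt_deriv h13 t)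
      (fun t _ => (hwd hw).hasDerivAt_deriv (by norm_num) t) h ?_ hwC
    intro t ht
    refine (abs_sub _ _).trans ?_
    rw [abs_mul, abs_mul, two_mul]
    exact add_le_add (mul_le_mul (hbA t ht).1 (hwC t ht) (abs_nonneg _) hA0)
      (mul_le_mul (hcA t ht).1 (hvC t ht) (abs_nonneg _) hA0)
  have hw₁B := fun t ht => (hwB t ht).1
  have hw₂B := fun t ht => (hwB t ht).2
  have hw₁' := hlayer hε₁ (h12.le.trans hε₂1) ha₁s ha₁ hA₁ hA₃ hA₄ hw₁ hw₁B hw₂B hode₁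
  have hw₂' := hlayer hε₂ hε₂1 ha₂s ha₂ hA₂ hA₆ hA₅ hw₂ hw₂B hw₁B hode₂
  obtain ⟨η₁, hη₁0, hη₁L, hη₁⟩ := exists_component_corrector hx hlog hε₁ hα hA0 hC₀ ha₁s hb₁₁s
    hb₁₂s hw₁ hw₂ ha₁ hA₁ hA₃ hA₄ hw₁B hw₂B hode₁ hw₁' hw₂' (hcell ε₁ (Or.inl rfl))
  obtain ⟨η₂, hη₂0, hη₂L, hη₂⟩ := exists_component_corrector hx hlog hε₂ hα hA0 hC₀ ha₂s hb₂₂s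
    hb₂₁s hw₂ hw₁ ha₂ hA₂ hA₆ hA₅ hw₂B hw₁B hode₂ hw₂' hw₁' (hcell ε₂ (Or.inr rfl))
  set κ := correctorConst α A C₀ * (Real.log N / N) with hκdef
  have hκ0 : 0 ≤ κ := by positivity
  have hF : ∀ {p q r s : ℝ}, |p| ≤ A → |q| ≤ κ → |r| ≤ A → |s| ≤ κ →
      |p * q - r * s| ≤ 2 * A * κ := by
    intro p q r s hp hq hr hs
    refine (abs_sub _ _).trans ?_
    rw [abs_mul, abs_mul, mul_assoc, two_mul]
    gcongr
  have hmem : ∀ j ≤ N, x j ∈ Icc (0 : ℝ) 1 := fun j hj => hx.mem_Icc hj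
  have hstab := discrete_system_abs_le hx.lt hε₁ hε₂ hβ hκ0 (by positivity : 0 ≤ 2 * A * κ)
    (fun j hj => hα.le.trans (ha₁ _ (hmem j hj))) (fun j hj => hα.le.trans (ha₂ _ (hmem j hj)))
    (fun j hj => hb₁ _ (hmem j hj)) (fun j hj => hb₂ _ (hmem j hj))
    (fun j hj => (hb₁₂ _ (hmem j hj)).le) (fun j hj => (hb₂₁ _ (hmem j hj)).le)
    (U := fun j => W₁ j - w₁ (x j) - η₁ j) (V := fun j => W₂ j - w₂ (x j) - η₂ j)
    (by simpa [hW₁0, hx.zero, hη₁0] using hκ0) (by simpa [hW₂0, hx.zero, hη₂0] using hκ0)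
    (by simpa [hW₁N, hx.last] using hη₁ N le_rfl) (by simpa [hW₂N, hx.last] using hη₂ N le_rfl)
    ?_ ?_
  · intro j hj
    obtain ⟨h1, h2⟩ := hstab j hj
    have hbound : ∀ {e y : ℝ}, |e - y| ≤ κ + 2 * A * κ / β → |y| ≤ κ →
        |e| ≤ (correctorConst α A C₀ * (2 + 2 * A / β) + 1) * Real.log N / N := by
      intro e y he hy
      have h3 : |e| ≤ |e - y| + |y| := by
        simpa using abs_add_le (e - y) y
      have h4 : (correctorConst α A C₀ * (2 + 2 * A / β) + 1) * Real.log N / N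
          = κ + 2 * A * κ / β + κ + Real.log N / N := by
        rw [hκdef]; ring
      have h5 : 0 ≤ Real.log N / N := by positivity
      linarith
    exact ⟨hbound h1 (hη₁ j hj), hbound h2 (hη₂ j hj)⟩
  · intro j hj
    have e : LN1 ε₁ a₁ b₁₁ b₁₂ x (fun j => W₁ j - w₁ (x j) - η₁ j)
        (fun j => W₂ j - w₂ (x j) - η₂ j) (j + 1)
        = b₁₁ (x (j + 1)) * η₁ (j + 1) - b₁₂ (x (j + 1)) * η₂ (j + 1) := by
      have h1 := (hW (j + 1) (by omega) hj).1
      have h2 := hη₁L j hj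
      simp only [LN1, delta2_succ, Dp] at h1 h2 ⊢
      linear_combination h1 - h2
    rw [e]
    exact hF (hA₃ _ (hmem _ hj.le)).1 (hη₁ _ hj.le) (hA₄ _ (hmem _ hj.le)).1 (hη₂ _ hj.le)
  · intro j hj
    have e : LN2 ε₂ a₂ b₂₂ b₂₁ x (fun j => W₁ j - w₁ (x j) - η₁ j)
        (fun j => W₂ j - w₂ (x j) - η₂ j) (j + 1)
        = b₂₂ (x (j + 1)) * η₂ (j + 1) - b₂₁ (x (j + 1)) * η₁ (j + 1) := by
      have h1 := (hW (j + 1) (by omega) hj).2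
      have h2 := hη₂L j hj
      simp only [LN2, delta2_succ, Dp] at h1 h2 ⊢
      linear_combination h1 - h2
    rw [e]
    exact hF (hA₆ _ (hmem _ hj.le)).1 (hη₂ _ hj.le) (hA₅ _ (hmem _ hj.le)).1 (hη₁ _ hj.le)
end
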